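/- arXiv:math/0502487 — 4 statements merged into one kernel-verified Lean document; each statement's English description precedes it below -/
import Mathlib

section
/- Let (a_n, b_n) be bounded Jacobi parameters with associated Jacobi operator J. If the part of the spectrum of J outside the interval [−2,2] is a finite set, then there exists k ≥ 0 such that the spectrum of the shifted Jacobi operator J^{(k)} is contained in [−2,2]. -/
open Complex Metric Filter Topology MeasureTheory

/-- `J` acts as the Jacobi matrix with parameters `a b` on `ℓ²(ℕ, ℝ)`; here `a n`, `b n`
denote the parameters `a_{n+1}`, `b_{n+1}` of the usual (1-indexed) notation, and
coordinate `n` of `ℓ²` corresponds to the (1-indexed) site `n+1`. -/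
def IsJacobiOp (a b : ℕ → ℝ)
    (J : lp (fun _ : ℕ => ℝ) 2 →L[ℝ] lp (fun _ : ℕ => ℝ) 2) : Prop :=
  ∀ f : lp (fun _ : ℕ => ℝ) 2,
    ((J f : ∀ _ : ℕ, ℝ) 0 = b 0 * (f : ∀ _ : ℕ, ℝ) 0 + a 0 * (f : ∀ _ : ℕ, ℝ) 1) ∧
    ∀ n : ℕ, (J f : ∀ _ : ℕ, ℝ) (n + 1) =
      a n * (f : ∀ _ : ℕ, ℝ) n + b (n + 1) * (f : ∀ _ : ℕ, ℝ) (n + 1) +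
        a (n + 1) * (f : ∀ _ : ℕ, ℝ) (n + 2)


section SelfAdjoint

open Polynomial

variable {H : Type*} [NormedAddCommGroup H] [InnerProductSpace ℝ H] [CompleteSpace H]

theorem IsSelfAdjoint.polynomial_aeval {T : H →L[ℝ] H} (hT : IsSelfAdjoint T) (p : ℝ[X]) :
    IsSelfAdjoint (aeval T p) := by
  induction p using Polynomial.induction_on' with
  | add p q hp hq => simpa using hp.add hq
  | monomial n c =>
    rw [aeval_monomial, ← Algebra.smul_def]
    exact (IsSelfAdjoint.all c).smul (hT.pow n)

theorem IsSelfAdjoint.isUnit_quadratic {T : H →L[ℝ] H} (hT : IsSelfAdjoint T) {z : ℂ}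
    (hz : z.im ≠ 0) : IsUnit (aeval T (X ^ 2 - C (2 * z.re) * X + C (‖z‖ ^ 2))) := by
  have hc : 0 < z.im ^ 2 := by positivity
  refine ContinuousLinearMap.isUnit_of_forall_le_norm_inner_map _ (c := ⟨z.im ^ 2, hc.le⟩) hc
    fun x => ?_
  have hsym : ∀ x y, inner ℝ (T x) y = inner ℝ x (T y) := hT.isSymmetric
  have hsq : inner ℝ (T (T x)) x = ‖T x‖ ^ 2 := by
    rw [hsym, real_inner_self_eq_norm_sq]
  have hpos : 0 ≤ ‖T x - z.re • x‖ ^ 2 := by positivity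
  rw [norm_sub_sq_real, norm_smul, inner_smul_right, mul_pow, Real.norm_eq_abs, sq_abs] at hpos
  have key : inner ℝ (aeval T (X ^ 2 - C (2 * z.re) * X + C (‖z‖ ^ 2)) x) x =
      ‖T x‖ ^ 2 - 2 * (z.re * inner ℝ (T x) x) + ‖z‖ ^ 2 * ‖x‖ ^ 2 := by
    simp [inner_add_left, inner_sub_left, inner_smul_left, pow_two T, hsq,
      Algebra.algebraMap_eq_smul_one]
    ring
  rw [key, Complex.sq_norm, Complex.normSq_apply]
  refine le_trans ?_ (le_abs_self _)
  change ‖x‖ ^ 2 * z.im ^ 2 ≤ _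
  nlinarith

/-- A real polynomial without zeros on the spectrum of a self-adjoint operator maps it to an
invertible operator. -/
theorem IsSelfAdjoint.isUnit_aeval {T : H →L[ℝ] H} (hT : IsSelfAdjoint T) (p : ℝ[X])
    (hp : p ≠ 0) (hspec : ∀ x ∈ spectrum ℝ T, p.eval x ≠ 0) : IsUnit (aeval T p) := by
  induction hn : p.natDegree using Nat.strong_induction_on generalizing p with
  | _ n ih =>
    subst hn
    by_cases hdeg : p.degree = 0
    · rw [eq_C_of_degree_eq_zero hdeg] at hp ⊢
      rw [aeval_C]
      exact (isUnit_iff_ne_zero.mpr fun h => hp (by rw [h, C_0])).map _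
    obtain ⟨z, hz⟩ := IsAlgClosed.exists_aeval_eq_zero ℂ p hdeg
    obtain ⟨d, hdvd, hddeg, hd⟩ : ∃ d : ℝ[X], d ∣ p ∧ 0 < d.natDegree ∧ IsUnit (aeval T d) := by
      by_cases him : z.im = 0
      · have hroot : p.eval z.re = 0 := by
          have hzre : z = algebraMap ℝ ℂ z.re := by
            apply Complex.ext <;> simp [him]
          rw [hzre, aeval_algebraMap_apply] at hz
          simpa using hz
        refine ⟨X - C z.re, dvd_iff_isRoot.mpr hroot, by simp, ?_⟩
        have hres := spectrum.notMem_iff.mp fun h => hspec z.re h hroot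
        simpa using hres.neg
      · refine ⟨_, quadratic_dvd_of_aeval_eq_zero_im_ne_zero p hz him, ?_,
          hT.isUnit_quadratic him⟩
        have : (X ^ 2 - C (2 * z.re) * X + C (‖z‖ ^ 2)).natDegree = 2 := by compute_degree!
        omega
    obtain ⟨r, rfl⟩ := hdvd
    have hr : r ≠ 0 := right_ne_zero_of_mul hp
    rw [map_mul]
    refine hd.mul (ih _ ?_ r hr (fun x hx h => hspec x hx (by simp [h])) rfl)
    rw [natDegree_mul (left_ne_zero_of_mul hp) hr]
    omega

theorem IsSelfAdjoint.inner_nonpos_of_spectrum_nonpos {S : H →L[ℝ] H} (hS : IsSelfAdjoint S)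
    (hspec : ∀ x ∈ spectrum ℝ S, x ≤ 0) (f : H) : inner ℝ (S f) f ≤ 0 := by
  rcases subsingleton_or_nontrivial H with hH | hH
  · simp [Subsingleton.elim f 0]
  have hB : IsSelfAdjoint (algebraMap ℝ (H →L[ℝ] H) ‖S‖ + S) :=
    ((IsSelfAdjoint.all ‖S‖).algebraMap _).add hS
  have hle : ‖algebraMap ℝ (H →L[ℝ] H) ‖S‖ + S‖ ≤ ‖S‖ := by
    have h := ContinuousLinearMap.spectralRadius_eq_nnnorm _ hB
    have h2 : spectralRadius ℝ (algebraMap ℝ (H →L[ℝ] H) ‖S‖ + S) ≤ (‖S‖₊ : ENNReal) := by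
      refine iSup₂_le fun x hx => ?_
      rw [← sub_add_cancel x ‖S‖, spectrum.add_mem_add_iff] at hx
      have h3 := spectrum.norm_le_norm_of_mem hx
      have h4 := hspec _ hx
      rw [Real.norm_eq_abs] at h3
      have h5 := abs_le.mp h3
      rw [ENNReal.coe_le_coe, ← NNReal.coe_le_coe, coe_nnnorm, coe_nnnorm, Real.norm_eq_abs,
        abs_le]
      constructor <;> linarith [norm_nonneg S]
    rw [h, ENNReal.coe_le_coe] at h2
    exact h2
  have h1 := real_inner_le_norm ((algebraMap ℝ (H →L[ℝ] H) ‖S‖ + S) f) f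
  have h2 : ‖(algebraMap ℝ (H →L[ℝ] H) ‖S‖ + S) f‖ * ‖f‖ ≤ ‖S‖ * ‖f‖ * ‖f‖ := by
    gcongr
    exact ContinuousLinearMap.le_of_opNorm_le _ hle f
  simp only [add_apply, inner_add_left, Algebra.algebraMap_eq_smul_one,
    smul_apply, one_apply_eq_self, inner_smul_left,
    real_inner_self_eq_norm_sq, conj_trivial] at h1 h2
  nlinarith

/-- If the spectrum of a self-adjoint operator `T` above `c` is contained in the finite set `F`,
then `T ≤ c` on the orthogonal complement of the kernel of `∏ x ∈ F, (T - x)`. -/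
theorem IsSelfAdjoint.inner_le_of_mem_orthogonal_ker {T : H →L[ℝ] H} (hT : IsSelfAdjoint T)
    (c : ℝ) (F : Finset ℝ) (hF : ∀ x ∈ spectrum ℝ T, c < x → x ∈ F) {v : H}
    (hv : v ∈ (aeval T (∏ x ∈ F, (X - C x))).kerᗮ) : inner ℝ (T v) v ≤ c * ‖v‖ ^ 2 := by
  set q : ℝ[X] := ∏ x ∈ F, (X - C x) with hq
  have hqT : IsSelfAdjoint (aeval T q) := hT.polynomial_aeval q
  have hnonpos : ∀ f, inner ℝ (aeval T ((X - C c) * q ^ 2) f) f ≤ 0 := by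
    refine (hT.polynomial_aeval _).inner_nonpos_of_spectrum_nonpos fun μ hμ => ?_
    by_contra! hpos
    refine spectrum.mem_iff.mp hμ ?_
    have hunit : IsUnit (aeval T (C μ - (X - C c) * q ^ 2)) := by
      have hval : ∀ x ∈ spectrum ℝ T, (C μ - (X - C c) * q ^ 2).eval x ≠ 0 := by
        intro x hx
        have : ((X - C c) * q ^ 2).eval x ≤ 0 := by
          by_cases hxc : c < x
          · have : q.eval x = 0 := by
              rw [hq, eval_prod]
              exact Finset.prod_eq_zero (hF x hx hxc) (by simp)
            simp [this]
          · simp only [eval_mul, eval_sub, eval_X, eval_C, eval_pow]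
            exact mul_nonpos_of_nonpos_of_nonneg (by linarith) (sq_nonneg _)
        simp only [eval_sub, eval_C] at this ⊢
        linarith
      refine hT.isUnit_aeval _ (fun h => ?_) hval
      have := congrArg (eval c) h
      simp at this
      linarith
    simpa using hunit
  rw [ContinuousLinearMap.orthogonal_ker, ← ContinuousLinearMap.star_eq_adjoint, hqT.star_eq] at hv
  have hclosed : IsClosed {w : H | inner ℝ (T w) w ≤ c * ‖w‖ ^ 2} :=
    isClosed_le (by fun_prop) (by fun_prop)
  refine closure_minimal (t := {w : H | inner ℝ (T w) w ≤ c * ‖w‖ ^ 2}) ?_ hclosed hv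
  rintro _ ⟨f, rfl⟩
  have h := hnonpos f
  have hsplit : aeval T ((X - C c) * q ^ 2) f =
      aeval T q (T (aeval T q f) - c • aeval T q f) := by
    rw [show (X - C c) * q ^ 2 = q * (X - C c) * q by ring]
    simp [Algebra.algebraMap_eq_smul_one]
  have hsym : ∀ x y, inner ℝ (aeval T q x) y = inner ℝ x (aeval T q y) := hqT.isSymmetric
  rw [hsplit, hsym, inner_sub_left, inner_smul_left, real_inner_self_eq_norm_sq] at h
  simpa using h

end SelfAdjoint

open Polynomial in
theorem finiteDimensional_ker_aeval_prod {H : Type*} [NormedAddCommGroup H]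
    [InnerProductSpace ℝ H] (T : H →L[ℝ] H)
    (hT : ∀ x : ℝ, FiniteDimensional ℝ (aeval T (X - C x)).ker) (F : Finset ℝ) :
    FiniteDimensional ℝ (aeval T (∏ x ∈ F, (X - C x))).ker := by
  induction F using Finset.induction_on with
  | empty =>
    have : (1 : H →L[ℝ] H).ker = ⊥ := by
      ext; simp
    rw [Finset.prod_empty, map_one, this]
    infer_instance
  | insert y F hy ih =>
    rw [Finset.prod_insert hy, mul_comm, map_mul]
    have := hT y
    change FiniteDimensional ℝ (Submodule.comap (aeval T (X - C y)).toLinearMap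
      (aeval T (∏ x ∈ F, (X - C x))).ker)
    infer_instance

theorem exists_finsupp_mem_orthogonal {H : Type*} [NormedAddCommGroup H] [InnerProductSpace ℝ H]
    (K : Submodule ℝ H) [FiniteDimensional ℝ K] (u : ℕ → H) :
    ∃ c : ℕ →₀ ℝ, c ≠ 0 ∧ ∑ i ∈ c.support, c i • u i ∈ Kᗮ := by
  let L : (ℕ →₀ ℝ) →ₗ[ℝ] K :=
    K.orthogonalProjectionOnto.toLinearMap ∘ₗ Finsupp.linearCombination ℝ u
  have hL : ¬ Function.Injective L := fun h =>
    not_finite_iff_infinite.mpr inferInstance (LinearIndependent.finite (R := ℝ) (M := K)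
      (f := fun i : ℕ => L (Finsupp.single i 1))
      ((Finsupp.basisSingleOne (R := ℝ) (ι := ℕ)).linearIndependent.map' L
        (LinearMap.ker_eq_bot.mpr h)))
  rw [← LinearMap.ker_eq_bot, Submodule.eq_bot_iff] at hL
  push Not at hL
  obtain ⟨c, hc, hc0⟩ := hL
  refine ⟨c, hc0, ?_⟩
  rw [← Submodule.orthogonalProjectionOnto_eq_zero_iff]
  exact hc

/-- If the form of `T - t` is positive and diagonal on a sequence of vectors, it is positive on
every nontrivial combination of them. -/
theorem lt_inner_sum_of_pairwise {H : Type*} [NormedAddCommGroup H] [InnerProductSpace ℝ H]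
    (T : H →L[ℝ] H) (t : ℝ) (u : ℕ → H) (hu : ∀ i, t * ‖u i‖ ^ 2 < inner ℝ (T (u i)) (u i))
    (horth : ∀ i j, i ≠ j → inner ℝ (u i) (u j) = 0)
    (hT : ∀ i j, i ≠ j → inner ℝ (T (u i)) (u j) = 0) (c : ℕ →₀ ℝ) (hc : c ≠ 0) :
    t * ‖∑ i ∈ c.support, c i • u i‖ ^ 2 <
      inner ℝ (T (∑ i ∈ c.support, c i • u i)) (∑ i ∈ c.support, c i • u i) := by
  have h1 : ‖∑ i ∈ c.support, c i • u i‖ ^ 2 = ∑ i ∈ c.support, c i ^ 2 * ‖u i‖ ^ 2 := by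
    rw [← real_inner_self_eq_norm_sq, sum_inner]
    refine Finset.sum_congr rfl fun i hi => ?_
    rw [inner_sum, Finset.sum_eq_single_of_mem i hi]
    · rw [inner_smul_left, inner_smul_right, real_inner_self_eq_norm_sq, conj_trivial]
      ring
    · intro j _ hji
      rw [inner_smul_left, inner_smul_right, horth i j hji.symm]
      simp
  have h2 : inner ℝ (T (∑ i ∈ c.support, c i • u i)) (∑ i ∈ c.support, c i • u i) =
      ∑ i ∈ c.support, c i ^ 2 * inner ℝ (T (u i)) (u i) := by
    rw [map_sum, sum_inner]
    refine Finset.sum_congr rfl fun i hi => ?_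
    rw [inner_sum, Finset.sum_eq_single_of_mem i hi]
    · rw [map_smul, inner_smul_left, inner_smul_right, conj_trivial]
      ring
    · intro j _ hji
      rw [map_smul, inner_smul_left, inner_smul_right, hT i j hji.symm]
      simp
  rw [h1, h2, Finset.mul_sum]
  refine Finset.sum_lt_sum_of_nonempty (Finsupp.support_nonempty_iff.mpr hc) fun i hi => ?_
  have : 0 < c i ^ 2 := by
    have := Finsupp.mem_support_iff.mp hi
    positivity
  nlinarith [hu i]

/-- The real Hilbert space `ℓ²(ℕ, ℝ)`. -/
abbrev RealEllTwo := lp (fun _ : ℕ => ℝ) 2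

namespace RealEllTwo

theorem inner_eq_zero_of_forall (f g : RealEllTwo) (h : ∀ n, f n = 0 ∨ g n = 0) :
    inner ℝ f g = 0 := by
  rw [lp.inner_eq_tsum]
  refine (tsum_congr fun n => ?_).trans tsum_zero
  rcases h n with h | h <;> simp [h]

theorem tendsto_coord_zero (f : RealEllTwo) : Tendsto (fun n => f n) atTop (𝓝 0) := by
  have h := (lp.summable_inner (𝕜 := ℝ) f f).tendsto_atTop_zero
  have h2 := h.sqrt
  simp only [real_inner_self_eq_norm_sq, Real.sqrt_zero, Real.sqrt_sq (norm_nonneg _)] at h2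
  exact tendsto_zero_iff_norm_tendsto_zero.mpr h2

/-- The truncation of a sequence to its first `m` coordinates. -/
noncomputable def trunc (f : RealEllTwo) (m : ℕ) : RealEllTwo :=
  ∑ i ∈ Finset.range m, lp.single 2 i (f i)

theorem trunc_apply (f : RealEllTwo) (m n : ℕ) : trunc f m n = if n < m then f n else 0 := by
  rw [trunc, lp.coeFn_sum, Finset.sum_apply]
  simp [Pi.single_apply]

theorem tendsto_trunc (f : RealEllTwo) : Tendsto (trunc f) atTop (𝓝 f) :=
  (lp.hasSum_single ENNReal.ofNat_ne_top f).tendsto_sum_nat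

theorem exists_shift (g : RealEllTwo) (k : ℕ) :
    ∃ f : RealEllTwo, (∀ n < k, f n = 0) ∧ ∀ n, f (n + k) = g n := by
  have hg := (lp.memℓp g).summable (by norm_num)
  have hf : Memℓp (fun n => if n < k then (0 : ℝ) else g (n - k)) 2 := by
    refine memℓp_gen ((summable_nat_add_iff k).mp ?_)
    simpa using hg
  exact ⟨⟨_, hf⟩, fun n hn => by simp [hn], fun n => by simp⟩

theorem inner_eq_of_shift {k : ℕ} {f g : RealEllTwo} {f' g' : RealEllTwo}
    (hf : ∀ n < k, f n = 0) (hfg : ∀ n, f (n + k) = g n)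
    (h' : ∀ n, f' (n + k) = g' n) : inner ℝ f' f = inner ℝ g' g := by
  rw [lp.inner_eq_tsum, lp.inner_eq_tsum,
    ← (lp.summable_inner (𝕜 := ℝ) f' f).sum_add_tsum_nat_add k]
  rw [Finset.sum_eq_zero fun n hn => by simp [hf n (Finset.mem_range.mp hn)], zero_add]
  simp only [hfg, h']

end RealEllTwo

namespace IsJacobiOp

variable {a b : ℕ → ℝ} {J : RealEllTwo →L[ℝ] RealEllTwo}

protected theorem neg (hJ : IsJacobiOp a b J) :
    IsJacobiOp (fun n => -a n) (fun n => -b n) (-J) := by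
  intro f
  refine ⟨?_, fun n => ?_⟩
  · simp [(hJ f).1]
    ring
  · simp [(hJ f).2 n]
    ring

theorem isSelfAdjoint (hJ : IsJacobiOp a b J) {C : ℝ} (hC : ∀ n, |a n| ≤ C) :
    IsSelfAdjoint J := by
  rw [ContinuousLinearMap.isSelfAdjoint_iff_isSymmetric]
  intro f g
  have h1 := (lp.hasSum_inner (𝕜 := ℝ) (J f) g).sub (lp.hasSum_inner (𝕜 := ℝ) f (J g))
  have hpart : ∀ n, ∑ i ∈ Finset.range (n + 1), (inner ℝ (J f i) (g i) - inner ℝ (f i) (J g i)) =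
      a n * (f (n + 1) * g n - f n * g (n + 1)) := by
    intro n
    induction n with
    | zero =>
      simp [(hJ f).1, (hJ g).1]
      ring
    | succ n ih =>
      rw [Finset.sum_range_succ, ih]
      simp [(hJ f).2, (hJ g).2]
      ring
  have h2 := (tendsto_add_atTop_iff_nat 1).mpr h1.tendsto_sum_nat
  simp only [hpart] at h2
  have hf := RealEllTwo.tendsto_coord_zero f
  have hg := RealEllTwo.tendsto_coord_zero g
  have hf1 := (tendsto_add_atTop_iff_nat 1).mpr hf
  have hg1 := (tendsto_add_atTop_iff_nat 1).mpr hg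
  have hdiff : Tendsto (fun n => f (n + 1) * g n - f n * g (n + 1)) atTop (𝓝 0) := by
    simpa using (hf1.mul hg).sub (hf.mul hg1)
  have h3 : Tendsto (fun n => a n * (f (n + 1) * g n - f n * g (n + 1))) atTop (𝓝 0) := by
    refine squeeze_zero_norm (fun n => ?_) (by simpa using hdiff.norm.const_mul C)
    rw [norm_mul, Real.norm_eq_abs]
    exact mul_le_mul_of_nonneg_right (hC n) (norm_nonneg _)
  exact sub_eq_zero.mp (tendsto_nhds_unique h2 h3)

theorem eq_zero_of_apply_eq_smul (hJ : IsJacobiOp a b J) (ha : ∀ n, a n ≠ 0) {x : ℝ}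
    {f : RealEllTwo} (hf : J f = x • f) (h0 : f 0 = 0) : f = 0 := by
  have key : ∀ n, f n = 0 ∧ f (n + 1) = 0 := by
    intro n
    induction n with
    | zero =>
      have h := (hJ f).1
      rw [hf] at h
      simpa [h0, ha 0] using h
    | succ n ih =>
      have h := (hJ f).2 n
      rw [hf] at h
      exact ⟨ih.2, by simpa [ih.1, ih.2, ha (n + 1)] using h⟩
  ext n
  exact (key n).1

open Polynomial in
theorem finiteDimensional_ker (hJ : IsJacobiOp a b J) (ha : ∀ n, a n ≠ 0) (x : ℝ) :
    FiniteDimensional ℝ (aeval J (X - C x)).ker := by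
  let φ : (aeval J (X - C x)).ker →ₗ[ℝ] ℝ :=
    { toFun := fun f => (f : RealEllTwo) 0
      map_add' := fun f g => by simp
      map_smul' := fun r f => by simp }
  refine FiniteDimensional.of_injective φ ((injective_iff_map_eq_zero φ).mpr fun f hf => ?_)
  have h := f.2
  rw [LinearMap.mem_ker] at h
  refine Subtype.ext (hJ.eq_zero_of_apply_eq_smul ha (x := x) ?_ hf)
  simpa [Algebra.algebraMap_eq_smul_one, sub_eq_zero] using h

theorem apply_eq_zero_of_forall_le (hJ : IsJacobiOp a b J) {m : ℕ} {f : RealEllTwo}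
    (hf : ∀ n ≤ m, f n = 0) {n : ℕ} (hn : n < m) : J f n = 0 := by
  cases n with
  | zero => simp [(hJ f).1, hf 0 (by omega), hf 1 (by omega)]
  | succ n => simp [(hJ f).2, hf n (by omega), hf (n + 1) (by omega), hf (n + 2) (by omega)]

theorem exists_truncation {t : ℝ} {k : ℕ} {f : RealEllTwo} (hf : ∀ n < k, f n = 0)
    (hlt : t * ‖f‖ ^ 2 < inner ℝ (J f) f) :
    ∃ m, ∃ g : RealEllTwo, (∀ n < k, g n = 0) ∧ (∀ n, m ≤ n → g n = 0) ∧
      t * ‖g‖ ^ 2 < inner ℝ (J g) g := by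
  have hopen : IsOpen {w : RealEllTwo | t * ‖w‖ ^ 2 < inner ℝ (J w) w} :=
    isOpen_lt (by fun_prop) (by fun_prop)
  obtain ⟨m, hm⟩ := ((RealEllTwo.tendsto_trunc f).eventually (hopen.mem_nhds hlt)).exists
  refine ⟨m, RealEllTwo.trunc f m, fun n hn => ?_, fun n hn => ?_, hm⟩
  · simp [RealEllTwo.trunc_apply, hf n hn]
  · simp [RealEllTwo.trunc_apply, hn]

/-- If the spectrum of a Jacobi operator above `t` is finite, its form is bounded by `t` on
sequences supported far enough from the origin. -/
theorem exists_forall_inner_le (hJ : IsJacobiOp a b J) (ha : ∀ n, a n ≠ 0) {C : ℝ}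
    (hC : ∀ n, |a n| ≤ C) {t : ℝ} (hfin : (spectrum ℝ J ∩ Set.Ioi t).Finite) :
    ∃ k, ∀ f : RealEllTwo, (∀ n < k, f n = 0) → inner ℝ (J f) f ≤ t * ‖f‖ ^ 2 := by
  by_contra! hcon
  have hsa := hJ.isSelfAdjoint hC
  have hsym : ∀ x y, inner ℝ (J x) y = inner ℝ x (J y) := hsa.isSymmetric
  have hex : ∀ k, ∃ m, ∃ g : RealEllTwo, (∀ n < k, g n = 0) ∧ (∀ n, m ≤ n → g n = 0) ∧
      t * ‖g‖ ^ 2 < inner ℝ (J g) g := fun k => by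
    obtain ⟨f, hf, hlt⟩ := hcon k
    exact exists_truncation hf hlt
  choose m g hg0 hgm hgt using hex
  let s : ℕ → ℕ := fun j => Nat.rec 0 (fun _ r => max r (m r + 1)) j
  have hs : ∀ j, s (j + 1) = max (s j) (m (s j) + 1) := fun _ => rfl
  have hmono : Monotone s := monotone_nat_of_le_succ fun j => by
    rw [hs]
    exact le_max_left _ _
  have hsep : ∀ i j, i < j → m (s i) < s j := fun i j hij =>
    lt_of_lt_of_le (by rw [hs]; exact lt_of_lt_of_le (Nat.lt_succ_self _) (le_max_right _ _))
      (hmono (Nat.succ_le_of_lt hij))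
  have horth : ∀ i j, i < j → inner ℝ (g (s i)) (g (s j)) = 0 := fun i j hij =>
    RealEllTwo.inner_eq_zero_of_forall _ _ fun n => by
      rcases le_or_gt (m (s i)) n with h | h
      · exact Or.inl (hgm _ n h)
      · exact Or.inr (hg0 _ n (h.trans (hsep i j hij)))
  have horthJ : ∀ i j, i < j → inner ℝ (g (s i)) (J (g (s j))) = 0 := fun i j hij =>
    RealEllTwo.inner_eq_zero_of_forall _ _ fun n => by
      rcases le_or_gt (m (s i)) n with h | h
      · exact Or.inl (hgm _ n h)
      · exact Or.inr (hJ.apply_eq_zero_of_forall_le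
          (fun l hl => hg0 _ l (lt_of_le_of_lt hl (hsep i j hij))) h)
  have hker := finiteDimensional_ker_aeval_prod J (hJ.finiteDimensional_ker ha) hfin.toFinset
  obtain ⟨c, hc0, hc⟩ := exists_finsupp_mem_orthogonal (Polynomial.aeval J
    (∏ x ∈ hfin.toFinset, (Polynomial.X - Polynomial.C x))).ker fun j => g (s j)
  have hle := hsa.inner_le_of_mem_orthogonal_ker t hfin.toFinset
    (fun x hx hxt => by simpa using ⟨hx, hxt⟩) hc
  refine absurd hle (not_le.mpr (lt_inner_sum_of_pairwise J t _ (fun i => hgt (s i)) ?_ ?_ c hc0))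
  · intro i j hij
    rcases lt_or_gt_of_ne hij with h | h
    · exact horth i j h
    · rw [real_inner_comm]
      exact horth j i h
  · intro i j hij
    rcases lt_or_gt_of_ne hij with h | h
    · rw [hsym]
      exact horthJ i j h
    · rw [real_inner_comm]
      exact horthJ j i h

/-- The form of a shifted Jacobi operator is the restriction of the form of the original one. -/
theorem inner_le_of_shift (hJ : IsJacobiOp a b J) {k : ℕ} {Jk : RealEllTwo →L[ℝ] RealEllTwo}
    (hJk : IsJacobiOp (fun n => a (n + k)) (fun n => b (n + k)) Jk) {t : ℝ}
    (h : ∀ f : RealEllTwo, (∀ n < k, f n = 0) → inner ℝ (J f) f ≤ t * ‖f‖ ^ 2)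
    (g : RealEllTwo) : inner ℝ (Jk g) g ≤ t * ‖g‖ ^ 2 := by
  obtain ⟨f, hf, hfg⟩ := RealEllTwo.exists_shift g k
  have hJf : ∀ n, J f (n + k) = Jk g n := by
    intro n
    cases n with
    | zero =>
      rw [(hJk g).1, ← hfg, ← hfg, zero_add]
      cases k with
      | zero => simpa using (hJ f).1
      | succ k =>
        rw [(hJ f).2, hf k (by omega)]
        simp [add_left_comm]
    | succ n =>
      rw [(hJk g).2, ← hfg, ← hfg, ← hfg]
      have := (hJ f).2 (n + k)
      simp only [show n + 1 + k = n + k + 1 by omega, show n + 2 + k = n + k + 2 by omega, this]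
  have h1 := h f hf
  rwa [← real_inner_self_eq_norm_sq, RealEllTwo.inner_eq_of_shift hf hfg hfg,
    RealEllTwo.inner_eq_of_shift hf hfg hJf, real_inner_self_eq_norm_sq] at h1

end IsJacobiOp

theorem le_of_mem_spectrum_of_inner_le {H : Type*} [NormedAddCommGroup H] [InnerProductSpace ℝ H]
    [CompleteSpace H] {T : H →L[ℝ] H} {t : ℝ} (h : ∀ f, inner ℝ (T f) f ≤ t * ‖f‖ ^ 2) {x : ℝ}
    (hx : x ∈ spectrum ℝ T) : x ≤ t := by
  by_contra! hlt
  have hc : 0 < x - t := sub_pos.mpr hlt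
  refine hx (ContinuousLinearMap.isUnit_of_forall_le_norm_inner_map _ (c := ⟨x - t, hc.le⟩) hc
    fun f => (le_trans ?_ (le_abs_self _)))
  change ‖f‖ ^ 2 * (x - t) ≤ _
  simp only [sub_apply, inner_sub_left, Algebra.algebraMap_eq_smul_one, smul_apply,
    one_apply_eq_self, inner_smul_left, real_inner_self_eq_norm_sq, conj_trivial]
  linarith [h f]

theorem statement10 (a b : ℕ → ℝ) (hpos : ∀ n, 0 < a n)
    (hbdd : ∃ C : ℝ, ∀ n, |a n| ≤ C ∧ |b n| ≤ C)
    (J : lp (fun _ : ℕ => ℝ) 2 →L[ℝ] lp (fun _ : ℕ => ℝ) 2)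
    (hJ : IsJacobiOp a b J)
    (hfin : (spectrum ℝ J \ Set.Icc (-2 : ℝ) 2).Finite) :
    ∃ k : ℕ, ∀ Jk : lp (fun _ : ℕ => ℝ) 2 →L[ℝ] lp (fun _ : ℕ => ℝ) 2,
      IsJacobiOp (fun n => a (n + k)) (fun n => b (n + k)) Jk →
      spectrum ℝ Jk ⊆ Set.Icc (-2 : ℝ) 2 := by
  obtain ⟨C, hC⟩ := hbdd
  have hfin1 : (spectrum ℝ J ∩ Set.Ioi 2).Finite :=
    hfin.subset fun x hx => ⟨hx.1, fun h => not_lt.mpr h.2 hx.2⟩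
  have hfin2 : (spectrum ℝ (-J) ∩ Set.Ioi 2).Finite := by
    refine (hfin.image fun x => -x).subset fun x hx => ⟨-x, ⟨?_, fun h => ?_⟩, neg_neg x⟩
    · have := hx.1
      rwa [← spectrum.neg_eq, Set.mem_neg] at this
    · have h2 : 2 < x := hx.2
      linarith [h.1]
  obtain ⟨k₁, hk₁⟩ := hJ.exists_forall_inner_le (fun n => (hpos n).ne') (fun n => (hC n).1) hfin1
  obtain ⟨k₂, hk₂⟩ := hJ.neg.exists_forall_inner_le (fun n => (neg_ne_zero.mpr (hpos n).ne'))
    (fun n => by rw [abs_neg]; exact (hC n).1) hfin2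
  refine ⟨max k₁ k₂, fun Jk hJk x hx => ⟨?_, ?_⟩⟩
  · have h := le_of_mem_spectrum_of_inner_le (x := -x) (hJ.neg.inner_le_of_shift hJk.neg
      fun f hf => hk₂ f fun n hn => hf n (lt_max_of_lt_right hn))
      (by rwa [← spectrum.neg_eq, Set.neg_mem_neg])
    linarith
  · exact le_of_mem_spectrum_of_inner_le (hJ.inner_le_of_shift hJk
      fun f hf => hk₁ f fun n hn => hf n (lt_max_of_lt_left hn)) hx
end

section
/- Let (a_n, b_n) be Jacobi parameters with a_ℓ = 1 and b_ℓ = 0 for all ℓ ≥ n + 1. Then the Jost function satisfies u(z) = g_n(z), a polynomial of degree at most 2n. Moreover: if a_n ≠ 1, then u has degree exactly 2n with leading coefficient (1 − a_n^2)/(a_1 ⋯ a_n); and if a_n = 1 but b_n ≠ 0, then u has degree exactly 2n − 1 with leading coefficient −b_n/(a_1 ⋯ a_n). -/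
open Complex Metric Filter Topology MeasureTheory

/-- The Geronimo–Case recursion; here `a n`, `b n` denote the Jacobi parameters
`a_{n+1}`, `b_{n+1}` of the usual (1-indexed) notation. -/
def GCRec (a b : ℕ → ℝ) (c g : ℕ → ℂ → ℂ) : Prop :=
  (∀ z, c 0 z = 1) ∧ (∀ z, g 0 z = 1) ∧
  (∀ n z, (a n : ℂ) * c (n + 1) z = (z ^ 2 - (b n : ℂ) * z) * c n z + g n z) ∧
  (∀ n z, (a n : ℂ) * g (n + 1) z =
    ((1 - (a n : ℂ) ^ 2) * z ^ 2 - (b n : ℂ) * z) * c n z + g n z)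

/-- `v` is the Jost function of the Jacobi parameters `a b`: it is the pointwise limit
of the Geronimo–Case polynomials `g n` on the closed unit disc minus `±1`. -/
def IsJost (a b : ℕ → ℝ) (v : ℂ → ℂ) : Prop :=
  ∃ c g : ℕ → ℂ → ℂ, GCRec a b c g ∧
    ∀ z ∈ Metric.closedBall (0 : ℂ) 1 \ ({1, -1} : Set ℂ),
      Filter.Tendsto (fun n => g n z) Filter.atTop (nhds (v z))

namespace GCRec

open Polynomial

variable {a b : ℕ → ℝ} {c g c' g' : ℕ → ℂ → ℂ}

/-- The Geronimo–Case polynomials are determined by the Jacobi parameters. -/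
lemma unique (hpos : ∀ n, 0 < a n) (h : GCRec a b c g) (h' : GCRec a b c' g') (m : ℕ) (z : ℂ) :
    c' m z = c m z ∧ g' m z = g m z := by
  obtain ⟨hc0, hg0, hc, hg⟩ := h
  obtain ⟨hc0', hg0', hc', hg'⟩ := h'
  induction m with
  | zero => simp [hc0, hg0, hc0', hg0']
  | succ m ih =>
    have ha : (a m : ℂ) ≠ 0 := by exact_mod_cast (hpos m).ne'
    constructor
    · apply mul_left_cancel₀ ha
      rw [hc', hc, ih.1, ih.2]
    · apply mul_left_cancel₀ ha
      rw [hg', hg, ih.1, ih.2]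

/-- `g` is constant from the index on from which the Jacobi parameters are free. -/
lemma eq_of_le (h : GCRec a b c g) {n : ℕ} (hfin : ∀ k, n ≤ k → a k = 1 ∧ b k = 0)
    {m : ℕ} (hm : n ≤ m) (z : ℂ) : g m z = g n z := by
  induction m, hm using Nat.le_induction with
  | base => rfl
  | succ m hm ih =>
    have hg := h.2.2.2 m z
    obtain ⟨ha, hb⟩ := hfin m hm
    simpa [ha, hb, ih] using hg

/-- The first Geronimo–Case polynomial `c n` has degree `2 n` with an explicit leading coefficient,
and `g n` has degree at most `2 n`. -/
lemma exists_polynomial (hpos : ∀ n, 0 < a n) (h : GCRec a b c g) (n : ℕ) :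
    ∃ C G : ℂ[X], (∀ z, c n z = C.eval z) ∧ (∀ z, g n z = G.eval z) ∧
      C.natDegree ≤ 2 * n ∧ G.natDegree ≤ 2 * n ∧
      C.coeff (2 * n) = (∏ k ∈ Finset.range n, (a k : ℂ))⁻¹ := by
  obtain ⟨hc0, hg0, hc, hg⟩ := h
  induction n with
  | zero => exact ⟨1, 1, by simp [hc0], by simp [hg0], by simp, by simp, by simp⟩
  | succ n ih =>
    obtain ⟨C, G, hC, hG, dC, dG, lC⟩ := ih
    have ha : (a n : ℂ) ≠ 0 := by exact_mod_cast (hpos n).ne'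
    refine ⟨Polynomial.C (a n : ℂ)⁻¹ * ((X ^ 2 - Polynomial.C (b n : ℂ) * X) * C + G),
      Polynomial.C (a n : ℂ)⁻¹ *
        ((Polynomial.C (1 - (a n : ℂ) ^ 2) * X ^ 2 - Polynomial.C (b n : ℂ) * X) * C + G),
      fun z => ?_, fun z => ?_, ?_, ?_, ?_⟩
    · apply mul_left_cancel₀ ha
      rw [hc, hC, hG]
      simp [mul_inv_cancel_left₀ ha]
    · apply mul_left_cancel₀ ha
      rw [hg, hC, hG]
      simp [mul_inv_cancel_left₀ ha]
    · have : (X ^ 2 - Polynomial.C (b n : ℂ) * X).natDegree ≤ 2 := by compute_degree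
      refine natDegree_C_mul_le _ _ |>.trans <| natDegree_add_le_of_degree_le ?_ (by lia)
      exact natDegree_mul_le.trans (by lia)
    · have : (Polynomial.C (1 - (a n : ℂ) ^ 2) * X ^ 2 -
          Polynomial.C (b n : ℂ) * X).natDegree ≤ 2 := by compute_degree
      refine natDegree_C_mul_le _ _ |>.trans <| natDegree_add_le_of_degree_le ?_ (by lia)
      exact natDegree_mul_le.trans (by lia)
    · have e1 : C.coeff (2 * n + 1) = 0 := coeff_eq_zero_of_natDegree_lt (by lia)
      have e2 : G.coeff (2 * n + 2) = 0 := coeff_eq_zero_of_natDegree_lt (by lia)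
      rw [show 2 * (n + 1) = 2 * n + 2 by ring, sub_mul, mul_assoc, Finset.prod_range_succ,
        coeff_C_mul, coeff_add, coeff_sub, coeff_X_pow_mul, coeff_C_mul, coeff_X_mul, e1, e2, lC,
        mul_inv]
      ring

end GCRec

lemma Polynomial.degree_leadingCoeff_of_coeff {R : Type*} [Semiring R] {P : Polynomial R} {d : ℕ}
    {r : R} (hd : P.natDegree ≤ d) (hr : P.coeff d = r) (h0 : r ≠ 0) :
    P.degree = d ∧ P.leadingCoeff = r := by
  subst hr
  have h : P.natDegree = d := Polynomial.natDegree_eq_of_le_of_coeff_ne_zero hd h0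
  refine ⟨?_, by rw [← h]; rfl⟩
  rw [← h]
  exact Polynomial.degree_eq_natDegree (by rintro rfl; simp at h0)

theorem statement13 (a b : ℕ → ℝ) (hpos : ∀ n, 0 < a n)
    (c g : ℕ → ℂ → ℂ) (hgc : GCRec a b c g)
    (n : ℕ) (hn : 1 ≤ n)
    (hfin : ∀ k, n ≤ k → a k = 1 ∧ b k = 0) :
    (∀ m, n ≤ m → ∀ z, g m z = g n z) ∧
    (∀ u : ℂ → ℂ, IsJost a b u →
      ∀ z ∈ Metric.closedBall (0 : ℂ) 1 \ ({1, -1} : Set ℂ), u z = g n z) ∧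
    ∃ P : Polynomial ℂ, (∀ z, g n z = P.eval z) ∧ P.natDegree ≤ 2 * n ∧
      (a (n - 1) ≠ 1 →
        P.degree = (2 * n : ℕ) ∧
        P.leadingCoeff = Complex.ofReal ((1 - a (n - 1) ^ 2) / ∏ k ∈ Finset.range n, a k)) ∧
      (a (n - 1) = 1 → b (n - 1) ≠ 0 →
        P.degree = (2 * n - 1 : ℕ) ∧
        P.leadingCoeff = Complex.ofReal (-b (n - 1) / ∏ k ∈ Finset.range n, a k)) := by
  refine ⟨fun m hm z => hgc.eq_of_le hfin hm z, ?_, ?_⟩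
  · rintro u ⟨c', g', hgc', hlim⟩ z hz
    refine tendsto_nhds_unique (hlim z hz) (tendsto_const_nhds.congr' ?_)
    filter_upwards [eventually_ge_atTop n] with m hm
    rw [(hgc.unique hpos hgc' m z).2, hgc.eq_of_le hfin hm z]
  obtain ⟨m, rfl⟩ : ∃ m, n = m + 1 := ⟨n - 1, by lia⟩
  rw [Nat.add_sub_cancel]
  obtain ⟨C, G, hC, hG, dC, dG, lC⟩ := hgc.exists_polynomial hpos m
  obtain ⟨-, P, -, hP, -, dP, -⟩ := hgc.exists_polynomial hpos (m + 1)
  have ha : (a m : ℂ) ≠ 0 := by exact_mod_cast (hpos m).ne'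
  have hprod : ∏ k ∈ Finset.range (m + 1), a k ≠ 0 :=
    Finset.prod_ne_zero_iff.2 fun k _ => (hpos k).ne'
  have key : Polynomial.C (a m : ℂ) * P =
      Polynomial.C (1 - (a m : ℂ) ^ 2) * (Polynomial.X ^ 2 * C) -
        Polynomial.C (b m : ℂ) * (Polynomial.X * C) + G := by
    refine Polynomial.funext fun z => ?_
    have := hgc.2.2.2 m z
    rw [hP, hC, hG] at this
    simp only [Polynomial.eval_mul, Polynomial.eval_C, Polynomial.eval_add, Polynomial.eval_sub,
      Polynomial.eval_pow, Polynomial.eval_X]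
    rw [this]
    ring
  have hC1 : C.coeff (2 * m + 1) = 0 := Polynomial.coeff_eq_zero_of_natDegree_lt (by lia)
  refine ⟨P, hP, dP, fun h1 => ?_, fun h1 hb => ?_⟩
  · refine Polynomial.degree_leadingCoeff_of_coeff dP ?_ ?_
    · have hG2 : G.coeff (2 * m + 2) = 0 := Polynomial.coeff_eq_zero_of_natDegree_lt (by lia)
      have hcoeff := congrArg (Polynomial.coeff · (2 * m + 2)) key
      simp only [Polynomial.coeff_C_mul, Polynomial.coeff_add, Polynomial.coeff_sub,
        Polynomial.coeff_X_pow_mul, Polynomial.coeff_X_mul, hC1, hG2, lC] at hcoeff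
      apply mul_left_cancel₀ ha
      rw [show 2 * (m + 1) = 2 * m + 2 by ring, hcoeff, Finset.prod_range_succ]
      push_cast
      rw [← div_div, mul_div_cancel₀ _ ha]
      ring
    · refine Complex.ofReal_ne_zero.2 (div_ne_zero (fun h => h1 ?_) hprod)
      nlinarith [hpos m]
  · have hG1 : G.coeff (2 * m + 1) = 0 := Polynomial.coeff_eq_zero_of_natDegree_lt (by lia)
    have hd : 2 * (m + 1) - 1 = 2 * m + 1 := by lia
    have key' : P = -(Polynomial.C (b m : ℂ) * (Polynomial.X * C)) + G := by
      simpa [h1] using key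
    rw [hd]
    refine Polynomial.degree_leadingCoeff_of_coeff ?_ ?_ ?_
    · rw [key']
      refine Polynomial.natDegree_add_le_of_degree_le ?_ (by lia)
      rw [Polynomial.natDegree_neg]
      refine (Polynomial.natDegree_C_mul_le _ _).trans (Polynomial.natDegree_mul_le.trans ?_)
      rw [Polynomial.natDegree_X]
      lia
    · rw [key']
      simp only [Polynomial.coeff_add, Polynomial.coeff_neg, Polynomial.coeff_C_mul,
        Polynomial.coeff_X_mul, hG1, lC, Finset.prod_range_succ, h1]
      push_cast
      ring
    · exact Complex.ofReal_ne_zero.2 (div_ne_zero (neg_ne_zero.2 hb) hprod)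
end

section
/- Let (a_n, b_n) be Jacobi parameters. (i) If Σ_{n≥1} (|b_n| + |a_n^2 − 1|) < ∞, then g_n converges uniformly on compact subsets of the closed unit disc minus {+1, −1}; the limit u is analytic on the open unit disc and continuous on the closed unit disc minus {+1, −1}; moreover, for every z in the open unit disc, lim_{n→∞} c_n(z) = u(z)/(1 − z^2). (ii) If Σ_{n≥1} n(|b_n| + |a_n^2 − 1|) < ∞, then g_n converges uniformly on the closed unit disc and u is continuous on the closed unit disc. (iii) If there are constants C > 0 and R > 1 with |b_n| + |a_n^2 − 1| ≤ C R^{-2n} for all n, then g_n converges uniformly on compact subsets of {z : |z| < R} and the limit is analytic there. -/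
open Complex Metric Filter Topology MeasureTheory

theorem prod_one_add_le_exp_tsum {s : ℕ → ℝ} (hs : ∀ n, 0 ≤ s n) (hsum : Summable s) (n : ℕ) :
    ∏ k ∈ Finset.range n, (1 + s k) ≤ Real.exp (∑' k, s k) := by
  calc ∏ k ∈ Finset.range n, (1 + s k)
      ≤ ∏ k ∈ Finset.range n, Real.exp (s k) :=
        Finset.prod_le_prod (fun k _ => by linarith [hs k])
          (fun k _ => by linarith [Real.add_one_le_exp (s k)])
    _ = Real.exp (∑ k ∈ Finset.range n, s k) := (Real.exp_sum _ _).symm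
    _ ≤ Real.exp (∑' k, s k) := Real.exp_le_exp.2 (hsum.sum_le_tsum _ fun k _ => hs k)

/-- A nonnegative sequence contracted by a factor `q < 1` up to summable errors tends to `0`. -/
theorem tendsto_zero_of_le_mul_add {x t : ℕ → ℝ} {q : ℝ} (hq : q < 1) (hx : ∀ n, 0 ≤ x n)
    (ht : ∀ n, 0 ≤ t n) (hsum : Summable t) (h : ∀ n, x (n + 1) ≤ q * x n + t n) :
    Tendsto x atTop (𝓝 0) := by
  have key : ∀ N, x N + (1 - q) * ∑ k ∈ Finset.range N, x k ≤
      x 0 + ∑ k ∈ Finset.range N, t k := by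
    intro N
    induction N with
    | zero => simp
    | succ N ih =>
      rw [Finset.sum_range_succ, Finset.sum_range_succ]
      linarith [h N]
  refine (summable_of_sum_range_le (c := (x 0 + ∑' k, t k) / (1 - q)) hx
    fun N => ?_).tendsto_atTop_zero
  rw [le_div_iff₀ (by linarith)]
  linarith [key N, hx N, hsum.sum_le_tsum (Finset.range N) fun k _ => ht k]

theorem exists_inv_bound {a d : ℕ → ℝ} (hpos : ∀ n, 0 < a n) (hd : Summable d)
    (had : ∀ n, |a n ^ 2 - 1| ≤ d n) :
    ∃ L : ℝ, 0 ≤ L ∧ (∀ n, (a n)⁻¹ ≤ L) ∧ ∀ n, |(a n)⁻¹ - 1| ≤ L * d n := by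
  have h0 : Tendsto (fun n => a n ^ 2 - 1) atTop (𝓝 0) :=
    squeeze_zero_norm had hd.tendsto_atTop_zero
  have h1 : Tendsto a atTop (𝓝 1) := by
    have h := (h0.add_const 1).sqrt
    simpa [Real.sqrt_sq (hpos _).le] using h
  obtain ⟨L, hL⟩ := (h1.inv₀ one_ne_zero).bddAbove_range
  have hL' : ∀ n, (a n)⁻¹ ≤ L := fun n => hL ⟨n, rfl⟩
  have hL0 : 0 ≤ L := (inv_pos.2 (hpos 0)).le.trans (hL' 0)
  refine ⟨L, hL0, hL', fun n => ?_⟩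
  have ha := hpos n
  have e : (a n)⁻¹ - 1 = (a n)⁻¹ * (1 - a n) := by field_simp
  have h2 : |1 - a n| ≤ |a n ^ 2 - 1| := by
    have : a n ^ 2 - 1 = -((1 - a n) * (1 + a n)) := by ring
    rw [this, abs_neg, abs_mul, abs_of_pos (by linarith : 0 < 1 + a n)]
    nlinarith [abs_nonneg (1 - a n)]
  rw [e, abs_mul, abs_of_pos (inv_pos.2 ha)]
  exact mul_le_mul (hL' n) (h2.trans (had n)) (abs_nonneg _) hL0

namespace GCRec

variable {a b : ℕ → ℝ} {c g : ℕ → ℂ → ℂ}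

theorem c_succ (h : GCRec a b c g) (hpos : ∀ n, 0 < a n) (n : ℕ) (z : ℂ) :
    c (n + 1) z = ((a n)⁻¹ : ℝ) * ((z ^ 2 - (b n : ℂ) * z) * c n z + g n z) := by
  have : (a n : ℂ) ≠ 0 := by exact_mod_cast (hpos n).ne'
  rw [← h.2.2.1 n z]
  push_cast
  field_simp

theorem g_succ (h : GCRec a b c g) (hpos : ∀ n, 0 < a n) (n : ℕ) (z : ℂ) :
    g (n + 1) z =
      ((a n)⁻¹ : ℝ) * (((1 - (a n : ℂ) ^ 2) * z ^ 2 - (b n : ℂ) * z) * c n z + g n z) := by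
  have : (a n : ℂ) ≠ 0 := by exact_mod_cast (hpos n).ne'
  rw [← h.2.2.2 n z]
  push_cast
  field_simp

theorem differentiable (h : GCRec a b c g) (hpos : ∀ n, 0 < a n) (n : ℕ) :
    Differentiable ℂ (c n) ∧ Differentiable ℂ (g n) := by
  induction n with
  | zero =>
    rw [show c 0 = fun _ => 1 from funext h.1, show g 0 = fun _ => 1 from funext h.2.1]
    exact ⟨differentiable_const _, differentiable_const _⟩
  | succ n ih =>
    obtain ⟨hc, hg⟩ := ih
    rw [show c (n + 1) = _ from funext (h.c_succ hpos n),
      show g (n + 1) = _ from funext (h.g_succ hpos n)]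
    constructor <;> fun_prop

theorem norm_coeff_le (a b : ℝ) {z : ℂ} {r : ℝ} (hr : 1 ≤ r) (hz : ‖z‖ ≤ r) :
    ‖(1 - (a : ℂ) ^ 2) * z ^ 2 - (b : ℂ) * z‖ ≤ r ^ 2 * (|b| + |a ^ 2 - 1|) := by
  have e : ‖(1 - (a : ℂ) ^ 2)‖ = |a ^ 2 - 1| := by
    rw [← norm_neg, neg_sub, ← Real.norm_eq_abs, ← Complex.norm_real]
    push_cast
    rfl
  refine (norm_sub_le _ _).trans ?_
  rw [norm_mul, norm_mul, e, norm_pow, Complex.norm_real, Real.norm_eq_abs]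
  have h1 : ‖z‖ ^ 2 ≤ r ^ 2 := pow_le_pow_left₀ (norm_nonneg _) hz 2
  have h2 : ‖z‖ ≤ r ^ 2 := by nlinarith
  nlinarith [mul_le_mul_of_nonneg_left h1 (abs_nonneg (a ^ 2 - 1)),
    mul_le_mul_of_nonneg_left h2 (abs_nonneg b)]

/-- Uniform convergence of `g n` from weighted bounds on `c n` and bounds on `g n`. -/
theorem tendstoUniformlyOn_of_bound (h : GCRec a b c g) (hpos : ∀ n, 0 < a n) {S : Set ℂ}
    {r B : ℝ} (hr : 1 ≤ r) (hS : ∀ z ∈ S, ‖z‖ ≤ r) {w : ℕ → ℝ} (hw : ∀ n, 1 ≤ w n)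
    (hsum : Summable fun n => w n * (|b n| + |a n ^ 2 - 1|))
    (hg : ∀ n, ∀ z ∈ S, ‖g n z‖ ≤ B) (hc : ∀ n, ∀ z ∈ S, ‖c n z‖ ≤ w n * B) :
    TendstoUniformlyOn g (fun z => limUnder atTop fun n => g n z) atTop S := by
  set d : ℕ → ℝ := fun n => |b n| + |a n ^ 2 - 1| with hd
  have hd0 : ∀ n, 0 ≤ d n := fun n => by positivity
  have hdsum : Summable d :=
    hsum.of_nonneg_of_le hd0 fun n => le_mul_of_one_le_left (hd0 n) (hw n)
  obtain ⟨L, hL0, hL, hL1⟩ := exists_inv_bound hpos hdsum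
    fun n => le_add_of_nonneg_left (abs_nonneg (b n))
  have hstep : ∀ n, ∀ z ∈ S, ‖g (n + 1) z - g n z‖ ≤
      L * d n * B + L * (r ^ 2 * d n * (w n * B)) := by
    intro n z hz
    have hB : 0 ≤ B := (norm_nonneg _).trans (hg 0 z hz)
    have e : g (n + 1) z - g n z = (((a n)⁻¹ - 1 : ℝ) : ℂ) * g n z +
        ((a n)⁻¹ : ℝ) * (((1 - (a n : ℂ) ^ 2) * z ^ 2 - (b n : ℂ) * z) * c n z) := by
      rw [h.g_succ hpos n z]
      push_cast
      ring
    rw [e]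
    refine (norm_add_le _ _).trans (add_le_add ?_ ?_)
    · rw [norm_mul, Complex.norm_real, Real.norm_eq_abs]
      exact mul_le_mul (hL1 n) (hg n z hz) (norm_nonneg _) (mul_nonneg hL0 (hd0 n))
    · rw [norm_mul, norm_mul, Complex.norm_real, Real.norm_eq_abs,
        abs_of_pos (inv_pos.2 (hpos n))]
      refine mul_le_mul (hL n) ?_ (by positivity) hL0
      exact mul_le_mul (norm_coeff_le _ _ hr (hS z hz)) (hc n z hz) (norm_nonneg _)
        (mul_nonneg (sq_nonneg r) (hd0 n))
  have hmaj : Summable fun n => L * d n * B + L * (r ^ 2 * d n * (w n * B)) := by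
    refine ((hdsum.mul_left L).mul_right B).add ?_
    refine (hsum.mul_left (L * r ^ 2 * B)).congr fun n => ?_
    simp only [hd]
    ring
  have hU := tendstoUniformlyOn_tsum_nat hmaj hstep
  have hV : TendstoUniformlyOn g (fun z => 1 + ∑' n, (g (n + 1) z - g n z)) atTop S := by
    rw [Metric.tendstoUniformlyOn_iff] at hU ⊢
    intro ε hε
    filter_upwards [hU ε hε] with n hn z hz
    have := hn z hz
    rw [Finset.sum_range_sub (fun n => g n z), h.2.1 z] at this
    rw [dist_eq_norm] at this ⊢
    convert this using 2
    ring
  exact hV.congr_right fun z hz => ((hV.tendsto_at hz).limUnder_eq).symm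

theorem le_bound_step {x M L d κ v A : ℝ} (hM : 0 ≤ M) (hA : 0 ≤ A) (hAL : A ≤ L)
    (hA1 : |A - 1| ≤ L * d) (hκv : 0 ≤ κ * v) (hx : x ≤ M * (1 + κ * v)) :
    A * x ≤ M * (1 + (L * d + L * (κ * v))) := by
  have h1 : A * x ≤ A * (M * (1 + κ * v)) := mul_le_mul_of_nonneg_left hx hA
  have h2 : A * (1 + κ * v) ≤ 1 + (L * d + L * (κ * v)) := by
    nlinarith [le_abs_self (A - 1), mul_le_mul_of_nonneg_right hAL hκv]
  nlinarith [mul_le_mul_of_nonneg_left h2 hM]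

/-- Bounds for `g n` and `c n` on a disc of radius `r ≥ 1`. -/
theorem exists_bound_closedBall (h : GCRec a b c g) (hpos : ∀ n, 0 < a n) {r : ℝ} (hr : 1 ≤ r)
    (hsum : Summable fun n : ℕ => ((n : ℝ) + 1) * r ^ (2 * n) * (|b n| + |a n ^ 2 - 1|)) :
    ∃ B : ℝ, ∀ n, ∀ z ∈ closedBall (0 : ℂ) r,
      ‖g n z‖ ≤ B ∧ ‖c n z‖ ≤ ((n : ℝ) + 1) * r ^ (2 * n) * B := by
  set d : ℕ → ℝ := fun n => |b n| + |a n ^ 2 - 1| with hd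
  have hd0 : ∀ n, 0 ≤ d n := fun n => by positivity
  have hrp : ∀ n : ℕ, 1 ≤ r ^ n := fun n => one_le_pow₀ hr
  have hw : ∀ n : ℕ, 1 ≤ ((n : ℝ) + 1) * r ^ (2 * n) := fun n => by
    nlinarith [hrp (2 * n), (Nat.cast_nonneg n : (0 : ℝ) ≤ n)]
  have hdsum : Summable d :=
    hsum.of_nonneg_of_le hd0 fun n => le_mul_of_one_le_left (hd0 n) (hw n)
  obtain ⟨L, hL0, hL, hL1⟩ := exists_inv_bound hpos hdsum
    fun n => le_add_of_nonneg_left (abs_nonneg (b n))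
  set s : ℕ → ℝ := fun n => L * d n + L * (r ^ 2 * (((n : ℝ) + 1) * r ^ (2 * n) * d n)) with hs
  have hv0 : ∀ n : ℕ, 0 ≤ r ^ 2 * (((n : ℝ) + 1) * r ^ (2 * n) * d n) := fun n =>
    mul_nonneg (sq_nonneg r) (mul_nonneg (by linarith [hw n]) (hd0 n))
  have hs0 : ∀ n, 0 ≤ s n := fun n =>
    add_nonneg (mul_nonneg hL0 (hd0 n)) (mul_nonneg hL0 (hv0 n))
  have hssum : Summable s :=
    (hdsum.mul_left L).add ((hsum.mul_left (r ^ 2)).mul_left L)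
  have key : ∀ n, ∀ z ∈ closedBall (0 : ℂ) r,
      ‖g n z‖ ≤ ∏ k ∈ Finset.range n, (1 + s k) ∧
      ‖c n z‖ ≤ ((n : ℝ) + 1) * r ^ (2 * n) * ∏ k ∈ Finset.range n, (1 + s k) := by
    intro n z hz
    rw [mem_closedBall_zero_iff] at hz
    induction n with
    | zero => simp [h.1 z, h.2.1 z]
    | succ n ih =>
      obtain ⟨ihg, ihc⟩ := ih
      rw [Finset.prod_range_succ]
      set M := ∏ k ∈ Finset.range n, (1 + s k)
      have hM : 0 ≤ M := (norm_nonneg _).trans ihg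
      have hA := inv_pos.2 (hpos n)
      set w := ((n : ℝ) + 1) * r ^ (2 * n) with hwdef
      have hw1 : 1 ≤ w := hw n
      constructor
      · rw [h.g_succ hpos, norm_mul, Complex.norm_real, Real.norm_eq_abs, abs_of_pos hA]
        refine le_bound_step hM hA.le (hL n) (hL1 n) (hv0 n) ?_
        refine (norm_add_le _ _).trans ?_
        rw [norm_mul]
        have := mul_le_mul (norm_coeff_le (a n) (b n) hr hz) ihc (norm_nonneg _)
          (mul_nonneg (sq_nonneg r) (hd0 n))
        simp only [hd]
        linarith
      · have hw' : (((n + 1 : ℕ) : ℝ) + 1) * r ^ (2 * (n + 1)) =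
            r ^ 2 * w + r ^ (2 * (n + 1)) := by
          rw [hwdef]
          push_cast
          ring
        have hw2 := hw (n + 1)
        set w' := (((n + 1 : ℕ) : ℝ) + 1) * r ^ (2 * (n + 1))
        rw [h.c_succ hpos, norm_mul, Complex.norm_real, Real.norm_eq_abs, abs_of_pos hA,
          ← mul_assoc]
        refine le_bound_step (by positivity) hA.le (hL n) (hL1 n) (hv0 n) ?_
        have hz2 : ‖z ^ 2 - (b n : ℂ) * z‖ ≤ r ^ 2 + r ^ 2 * d n := by
          refine (norm_sub_le _ _).trans ?_
          rw [norm_mul, norm_pow, Complex.norm_real, Real.norm_eq_abs]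
          have h1 : ‖z‖ ^ 2 ≤ r ^ 2 := pow_le_pow_left₀ (norm_nonneg _) hz 2
          have h2 : ‖z‖ ≤ r ^ 2 := by nlinarith
          have h3 : |b n| ≤ d n := le_add_of_nonneg_right (abs_nonneg _)
          have := mul_le_mul h3 h2 (norm_nonneg _) (hd0 n)
          linarith
        have h1 : ‖(z ^ 2 - (b n : ℂ) * z) * c n z + g n z‖ ≤
            (r ^ 2 + r ^ 2 * d n) * (w * M) + M := by
          refine (norm_add_le _ _).trans (add_le_add ?_ ihg)
          rw [norm_mul]
          exact mul_le_mul hz2 ihc (norm_nonneg _) (by have := hd0 n; positivity)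
        have h2 : M * 1 ≤ M * r ^ (2 * (n + 1)) := mul_le_mul_of_nonneg_left (hrp _) hM
        have h3 : 1 * (r ^ 2 * (w * d n) * M) ≤ w' * (r ^ 2 * (w * d n) * M) :=
          mul_le_mul_of_nonneg_right hw2 (mul_nonneg (hv0 n) hM)
        calc _ ≤ _ := h1
          _ ≤ (r ^ 2 * w + r ^ (2 * (n + 1))) * M + w' * (r ^ 2 * (w * d n) * M) := by
            linarith
          _ = _ := by rw [← hw']; ring
  refine ⟨Real.exp (∑' k, s k), fun n z hz => ?_⟩
  have hB := prod_one_add_le_exp_tsum hs0 hssum n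
  exact ⟨(key n z hz).1.trans hB, (key n z hz).2.trans
    (mul_le_mul_of_nonneg_left hB (by linarith [hw n]))⟩

theorem tendstoUniformlyOn_closedBall (h : GCRec a b c g) (hpos : ∀ n, 0 < a n) {r : ℝ}
    (hr : 1 ≤ r)
    (hsum : Summable fun n : ℕ => ((n : ℝ) + 1) * r ^ (2 * n) * (|b n| + |a n ^ 2 - 1|)) :
    TendstoUniformlyOn g (fun z => limUnder atTop fun n => g n z) atTop
      (closedBall (0 : ℂ) r) := by
  obtain ⟨B, hB⟩ := h.exists_bound_closedBall hpos hr hsum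
  refine h.tendstoUniformlyOn_of_bound hpos hr (fun z hz => mem_closedBall_zero_iff.1 hz)
    (fun n => ?_) hsum (fun n z hz => (hB n z hz).1) (fun n z hz => (hB n z hz).2)
  nlinarith [one_le_pow₀ hr (n := 2 * n), (Nat.cast_nonneg n : (0 : ℝ) ≤ n)]

/-- The combination `(1 - z²) cₙ - gₙ` satisfies a perturbed contraction. -/
theorem diff_succ (h : GCRec a b c g) (hpos : ∀ n, 0 < a n) (n : ℕ) (z : ℂ) :
    (1 - z ^ 2) * c (n + 1) z - g (n + 1) z =
      ((a n)⁻¹ : ℝ) * (z ^ 2 * ((1 - z ^ 2) * c n z - g n z) -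
        ((1 - z ^ 2) * ((b n : ℂ) * z) +
          ((1 - (a n : ℂ) ^ 2) * z ^ 2 - (b n : ℂ) * z)) * c n z) := by
  rw [h.c_succ hpos, h.g_succ hpos]
  ring

theorem norm_diff_coeff_le (a b : ℝ) {z : ℂ} (hz : ‖z‖ ≤ 1) :
    ‖(1 - z ^ 2) * ((b : ℂ) * z) + ((1 - (a : ℂ) ^ 2) * z ^ 2 - (b : ℂ) * z)‖ ≤
      3 * (|b| + |a ^ 2 - 1|) := by
  have h1 := norm_coeff_le a b le_rfl hz
  have h2 : ‖1 - z ^ 2‖ ≤ 2 := by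
    refine (norm_sub_le _ _).trans ?_
    rw [norm_one, norm_pow]
    nlinarith [norm_nonneg z]
  have h3 : ‖(b : ℂ) * z‖ ≤ |b| := by
    rw [norm_mul, Complex.norm_real, Real.norm_eq_abs]
    exact mul_le_of_le_one_right (abs_nonneg _) hz
  refine (norm_add_le _ _).trans ?_
  rw [norm_mul]
  have := mul_le_mul h2 h3 (norm_nonneg _) zero_le_two
  linarith [abs_nonneg (a ^ 2 - 1)]

/-- Bounds away from `±1` in the closed unit disc. -/
theorem exists_bound_of_le_norm (h : GCRec a b c g) (hpos : ∀ n, 0 < a n) {η : ℝ} (hη : 0 < η)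
    (hsum : Summable fun n => |b n| + |a n ^ 2 - 1|) :
    ∃ B : ℝ, ∀ n z, ‖z‖ ≤ 1 → η ≤ ‖1 - z ^ 2‖ →
      ‖(1 - z ^ 2) * c n z - g n z‖ ≤ B ∧ ‖g n z‖ ≤ B ∧ ‖c n z‖ ≤ B := by
  set d : ℕ → ℝ := fun n => |b n| + |a n ^ 2 - 1| with hd
  have hd0 : ∀ n, 0 ≤ d n := fun n => by positivity
  obtain ⟨L, hL0, hL, hL1⟩ := exists_inv_bound hpos hsum
    fun n => le_add_of_nonneg_left (abs_nonneg (b n))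
  set s : ℕ → ℝ := fun n => L * d n + L * (4 / η * d n) with hs
  have hv0 : ∀ n, 0 ≤ 4 / η * d n := fun n => mul_nonneg (by positivity) (hd0 n)
  have hs0 : ∀ n, 0 ≤ s n := fun n =>
    add_nonneg (mul_nonneg hL0 (hd0 n)) (mul_nonneg hL0 (hv0 n))
  have hssum : Summable s := (hsum.mul_left L).add ((hsum.mul_left (4 / η)).mul_left L)
  have hcle : ∀ n z, η ≤ ‖1 - z ^ 2‖ →
      ‖c n z‖ ≤ (‖(1 - z ^ 2) * c n z - g n z‖ + ‖g n z‖) / η := by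
    intro n z hz
    rw [le_div_iff₀ hη]
    calc ‖c n z‖ * η ≤ ‖c n z‖ * ‖1 - z ^ 2‖ := by gcongr
      _ = ‖((1 - z ^ 2) * c n z - g n z) + g n z‖ := by
        rw [sub_add_cancel, norm_mul, mul_comm]
      _ ≤ _ := norm_add_le _ _
  have key : ∀ n z, ‖z‖ ≤ 1 → η ≤ ‖1 - z ^ 2‖ →
      ‖(1 - z ^ 2) * c n z - g n z‖ + ‖g n z‖ ≤ 2 * ∏ k ∈ Finset.range n, (1 + s k) := by
    intro n z hz hzη
    induction n with
    | zero =>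
      have : ‖z‖ ^ 2 ≤ 1 := pow_le_one₀ (norm_nonneg _) hz
      simp only [h.1 z, h.2.1 z, Finset.range_zero, Finset.prod_empty, mul_one, norm_one]
      rw [sub_sub_cancel_left, norm_neg, norm_pow]
      linarith
    | succ n ih =>
      rw [Finset.prod_range_succ, ← mul_assoc]
      set M := 2 * ∏ k ∈ Finset.range n, (1 + s k)
      have hM : 0 ≤ M := (by positivity : (0 : ℝ) ≤ _).trans ih
      have hA := inv_pos.2 (hpos n)
      rw [h.diff_succ hpos, h.g_succ hpos, norm_mul, norm_mul, Complex.norm_real,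
        Real.norm_eq_abs, abs_of_pos hA, ← mul_add]
      refine le_bound_step hM hA.le (hL n) (hL1 n) (hv0 n) ?_
      have hc : ‖c n z‖ ≤ M / η := (hcle n z hzη).trans (by gcongr)
      have hz2 : ‖z ^ 2‖ ≤ 1 := by
        rw [norm_pow]
        exact pow_le_one₀ (norm_nonneg _) hz
      have h1 := norm_sub_le (z ^ 2 * ((1 - z ^ 2) * c n z - g n z))
        (((1 - z ^ 2) * ((b n : ℂ) * z) +
          ((1 - (a n : ℂ) ^ 2) * z ^ 2 - (b n : ℂ) * z)) * c n z)
      have h2 := norm_add_le (((1 - (a n : ℂ) ^ 2) * z ^ 2 - (b n : ℂ) * z) * c n z) (g n z)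
      rw [norm_mul] at h2
      rw [norm_mul, norm_mul] at h1
      have h3 := mul_le_mul (norm_diff_coeff_le (a n) (b n) hz) hc (norm_nonneg _)
        (mul_nonneg zero_le_three (hd0 n))
      have h4 := mul_le_mul (norm_coeff_le (a n) (b n) le_rfl hz) hc (norm_nonneg _)
        (mul_nonneg (sq_nonneg 1) (hd0 n))
      have h5 := mul_le_of_le_one_left (norm_nonneg ((1 - z ^ 2) * c n z - g n z)) hz2
      have e : M * (1 + 4 / η * d n) = M + (3 * d n * (M / η) + 1 ^ 2 * d n * (M / η)) := by
        ring
      rw [e]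
      simp only [hd]
      linarith
  set E := 2 * Real.exp (∑' k, s k)
  have hE : ∀ n z, ‖z‖ ≤ 1 → η ≤ ‖1 - z ^ 2‖ →
      ‖(1 - z ^ 2) * c n z - g n z‖ + ‖g n z‖ ≤ E := fun n z h1 h2 =>
    (key n z h1 h2).trans
      (mul_le_mul_of_nonneg_left (prod_one_add_le_exp_tsum hs0 hssum n) zero_le_two)
  refine ⟨max E (E / η), fun n z h1 h2 => ?_⟩
  have h3 := hE n z h1 h2
  refine ⟨?_, ?_, ?_⟩
  · exact le_max_of_le_left (by linarith [norm_nonneg (g n z)])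
  · exact le_max_of_le_left (by linarith [norm_nonneg ((1 - z ^ 2) * c n z - g n z)])
  · exact le_max_of_le_right ((hcle n z h2).trans (by gcongr))

theorem one_sub_sq_ne_zero {z : ℂ} (hz : z ∉ ({1, -1} : Set ℂ)) : 1 - z ^ 2 ≠ 0 := by
  intro h
  exact hz (sq_eq_sq_iff_eq_or_eq_neg.1 (by rw [one_pow, ← sub_eq_zero.1 h]))

theorem tendstoUniformlyOn_of_isCompact (h : GCRec a b c g) (hpos : ∀ n, 0 < a n)
    (hsum : Summable fun n => |b n| + |a n ^ 2 - 1|) {K : Set ℂ} (hK : IsCompact K)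
    (hKS : K ⊆ closedBall (0 : ℂ) 1 \ ({1, -1} : Set ℂ)) :
    TendstoUniformlyOn g (fun z => limUnder atTop fun n => g n z) atTop K := by
  obtain ⟨η, hη, hηK⟩ : ∃ η : ℝ, 0 < η ∧ ∀ z ∈ K, η ≤ ‖1 - z ^ 2‖ :=
    hK.exists_forall_le' (f := fun z : ℂ => ‖1 - z ^ 2‖) (by fun_prop)
      (fun z hz => norm_pos_iff.2 (one_sub_sq_ne_zero (hKS hz).2))
  have hK1 : ∀ z ∈ K, ‖z‖ ≤ 1 := fun z hz => mem_closedBall_zero_iff.1 (hKS hz).1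
  obtain ⟨B, hB⟩ := h.exists_bound_of_le_norm hpos hη hsum
  refine h.tendstoUniformlyOn_of_bound hpos le_rfl hK1 (w := fun _ => 1) (fun _ => le_rfl)
    (by simpa using hsum) (fun n z hz => (hB n z (hK1 z hz) (hηK z hz)).2.1) fun n z hz => ?_
  rw [one_mul]
  exact (hB n z (hK1 z hz) (hηK z hz)).2.2

theorem tendsto_c (h : GCRec a b c g) (hpos : ∀ n, 0 < a n)
    (hsum : Summable fun n => |b n| + |a n ^ 2 - 1|) {z u : ℂ} (hz : ‖z‖ < 1)
    (hu : Tendsto (fun n => g n z) atTop (𝓝 u)) :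
    Tendsto (fun n => c n z) atTop (𝓝 (u / (1 - z ^ 2))) := by
  have hz2 : ‖z‖ ^ 2 < 1 := pow_lt_one₀ (norm_nonneg _) hz two_ne_zero
  have hne : 1 - z ^ 2 ≠ 0 := by
    intro h0
    rw [← norm_pow, ← sub_eq_zero.1 h0, norm_one] at hz2
    exact lt_irrefl _ hz2
  obtain ⟨B, hB⟩ := h.exists_bound_of_le_norm hpos (norm_pos_iff.2 hne) hsum
  obtain ⟨L, hL0, hL, hL1⟩ := exists_inv_bound hpos hsum
    fun n => le_add_of_nonneg_left (abs_nonneg (b n))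
  have hB0 : 0 ≤ B := (norm_nonneg _).trans (hB 0 z hz.le le_rfl).1
  have hdiff : Tendsto (fun n => (1 - z ^ 2) * c n z - g n z) atTop (𝓝 0) := by
    rw [tendsto_zero_iff_norm_tendsto_zero]
    refine tendsto_zero_of_le_mul_add (q := ‖z‖ ^ 2)
      (t := fun n => 4 * L * B * (|b n| + |a n ^ 2 - 1|)) hz2
      (fun n => norm_nonneg _) (fun n => by positivity) (hsum.mul_left _) fun n => ?_
    obtain ⟨hB1, -, hB3⟩ := hB n z hz.le le_rfl
    set x := (1 - z ^ 2) * c n z - g n z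
    set d := |b n| + |a n ^ 2 - 1|
    have hd : 0 ≤ d := by positivity
    set e := (1 - z ^ 2) * ((b n : ℂ) * z) + ((1 - (a n : ℂ) ^ 2) * z ^ 2 - (b n : ℂ) * z)
    have e1 : (1 - z ^ 2) * c (n + 1) z - g (n + 1) z =
        z ^ 2 * x + ((((a n)⁻¹ - 1 : ℝ) : ℂ) * (z ^ 2 * x) -
          ((a n)⁻¹ : ℝ) * (e * c n z)) := by
      rw [h.diff_succ hpos]
      push_cast
      ring
    rw [e1]
    refine (norm_add_le _ _).trans (add_le_add (by rw [norm_mul, norm_pow]) ?_)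
    refine (norm_sub_le _ _).trans ?_
    rw [norm_mul, norm_mul, norm_mul, norm_mul, norm_pow, Complex.norm_real, Complex.norm_real,
      Real.norm_eq_abs, Real.norm_eq_abs, abs_of_pos (inv_pos.2 (hpos n))]
    have h1 : ‖z‖ ^ 2 * ‖x‖ ≤ B := (mul_le_of_le_one_left (norm_nonneg _) hz2.le).trans hB1
    have h2 := mul_le_mul (hL1 n) h1 (by positivity) (mul_nonneg hL0 hd)
    have h3 : ‖e‖ * ‖c n z‖ ≤ 3 * d * B :=
      mul_le_mul (norm_diff_coeff_le _ _ hz.le) hB3 (norm_nonneg _) (by positivity)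
    have h4 := mul_le_mul (hL n) h3 (by positivity) hL0
    linarith
  have := (hdiff.add hu).div_const (1 - z ^ 2)
  rw [zero_add] at this
  refine this.congr fun n => ?_
  rw [sub_add_cancel, mul_div_cancel_left₀ _ hne]

end GCRec

/-- Uniform limits of continuous functions on compact subsets of a locally closed set. -/
theorem continuousOn_closed_diff_of_tendstoUniformlyOn {F : ℕ → ℂ → ℂ} {u : ℂ → ℂ}
    {s t : Set ℂ} (hs : IsClosed s) (ht : IsClosed t) (hF : ∀ n, Continuous (F n))
    (h : ∀ K, IsCompact K → K ⊆ s \ t → TendstoUniformlyOn F u atTop K) :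
    ContinuousOn u (s \ t) := by
  intro z hz
  obtain ⟨V, hV, hVt, hVc⟩ :=
    LocallyCompactSpace.local_compact_nhds z tᶜ (ht.isOpen_compl.mem_nhds hz.2)
  have hU := h (V ∩ s) (hVc.inter_right hs) fun x hx => ⟨hx.2, hVt hx.1⟩
  have hcont : ContinuousOn u (V ∩ s) :=
    hU.continuousOn (Frequently.of_forall fun n => (hF n).continuousOn)
  refine (hcont z ⟨mem_of_mem_nhds hV, hz.1⟩).mono_of_mem_nhdsWithin ?_
  filter_upwards [self_mem_nhdsWithin, mem_nhdsWithin_of_mem_nhds hV] with x hx hxV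
  exact ⟨hxV, hx.1⟩

theorem differentiableOn_of_tendstoUniformlyOn_isCompact {F : ℕ → ℂ → ℂ} {u : ℂ → ℂ}
    {U : Set ℂ} (hU : IsOpen U) (hF : ∀ n, Differentiable ℂ (F n))
    (h : ∀ K, IsCompact K → K ⊆ U → TendstoUniformlyOn F u atTop K) :
    DifferentiableOn ℂ u U :=
  ((tendstoLocallyUniformlyOn_iff_forall_isCompact hU).2
    fun K hKU hK => h K hK hKU).differentiableOn
      (Eventually.of_forall fun n => (hF n).differentiableOn) hU

theorem summable_weight_of_le_zpow {d : ℕ → ℝ} (hd : ∀ n, 0 ≤ d n) {C R r : ℝ} (hr : 0 ≤ r)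
    (hrR : r < R) (h : ∀ n : ℕ, d n ≤ C * R ^ (-(2 * ((n : ℤ) + 1)))) :
    Summable fun n : ℕ => ((n : ℝ) + 1) * r ^ (2 * n) * d n := by
  have hR : 0 < R := hr.trans_lt hrR
  set q := (r / R) ^ 2 with hq
  have hq1 : ‖q‖ < 1 := by
    rw [Real.norm_of_nonneg (sq_nonneg _)]
    exact pow_lt_one₀ (by positivity) ((div_lt_one hR).2 hrR) two_ne_zero
  have h1 := summable_pow_mul_geometric_of_norm_lt_one 1 hq1
  have h2 := summable_geometric_of_norm_lt_one hq1
  refine ((h1.add h2).mul_left (C * (R ^ 2)⁻¹)).of_nonneg_of_le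
    (fun n => mul_nonneg (by positivity) (hd n)) fun n => ?_
  refine (mul_le_mul_of_nonneg_left (h n) (by positivity)).trans_eq ?_
  have e : R ^ (-(2 * ((n : ℤ) + 1))) = (R ^ 2)⁻¹ * ((R ^ 2)⁻¹) ^ n := by
    rw [zpow_neg, show (2 * ((n : ℤ) + 1)) = ((2 * (n + 1) : ℕ) : ℤ) by push_cast; ring,
      zpow_natCast, pow_mul, pow_succ, inv_pow, mul_inv, mul_comm]
  rw [e, hq, div_pow, div_eq_mul_inv, mul_pow, pow_mul]
  ring

theorem statement15 (a b : ℕ → ℝ) (hpos : ∀ n, 0 < a n)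
    (c g : ℕ → ℂ → ℂ) (hgc : GCRec a b c g) :
    -- (i)
    ((Summable fun n => |b n| + |a n ^ 2 - 1|) →
      ∃ u : ℂ → ℂ,
        (∀ K : Set ℂ, IsCompact K →
          K ⊆ Metric.closedBall (0 : ℂ) 1 \ ({1, -1} : Set ℂ) →
          TendstoUniformlyOn (fun (n : ℕ) (z : ℂ) => g n z) u Filter.atTop K) ∧
        DifferentiableOn ℂ u (Metric.ball (0 : ℂ) 1) ∧
        ContinuousOn u (Metric.closedBall (0 : ℂ) 1 \ ({1, -1} : Set ℂ)) ∧
        ∀ z ∈ Metric.ball (0 : ℂ) 1,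
          Filter.Tendsto (fun n => c n z) Filter.atTop (nhds (u z / (1 - z ^ 2)))) ∧
    -- (ii)
    ((Summable fun n : ℕ => ((n : ℝ) + 1) * (|b n| + |a n ^ 2 - 1|)) →
      ∃ u : ℂ → ℂ,
        TendstoUniformlyOn (fun (n : ℕ) (z : ℂ) => g n z) u Filter.atTop
          (Metric.closedBall (0 : ℂ) 1) ∧
        ContinuousOn u (Metric.closedBall (0 : ℂ) 1)) ∧
    -- (iii)
    (∀ C₀ R : ℝ, 0 < C₀ → 1 < R →
      (∀ n : ℕ, |b n| + |a n ^ 2 - 1| ≤ C₀ * R ^ (-(2 * ((n : ℤ) + 1)))) →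
      ∃ u : ℂ → ℂ,
        (∀ K : Set ℂ, IsCompact K → K ⊆ Metric.ball (0 : ℂ) R →
          TendstoUniformlyOn (fun (n : ℕ) (z : ℂ) => g n z) u Filter.atTop K) ∧
        DifferentiableOn ℂ u (Metric.ball (0 : ℂ) R)) := by
  have hcont : ∀ n, Continuous (g n) := fun n => (hgc.differentiable hpos n).2.continuous
  refine ⟨fun hsum => ?_, fun hsum => ?_, fun C₀ R _ hR hle => ?_⟩
  · have hU := fun K (hK : IsCompact K) hKS =>
      hgc.tendstoUniformlyOn_of_isCompact hpos hsum (K := K) hK hKS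
    have hsub : ball (0 : ℂ) 1 ⊆ closedBall (0 : ℂ) 1 \ ({1, -1} : Set ℂ) := by
      refine fun z hz => ⟨ball_subset_closedBall hz, ?_⟩
      rintro (rfl | rfl) <;> simp at hz
    refine ⟨_, hU, ?_, ?_, fun z hz => ?_⟩
    · exact differentiableOn_of_tendstoUniformlyOn_isCompact isOpen_ball
        (fun n => (hgc.differentiable hpos n).2) fun K hK hKU => hU K hK (hKU.trans hsub)
    · exact continuousOn_closed_diff_of_tendstoUniformlyOn isClosed_closedBall
        (Set.toFinite _).isClosed hcont hU
    · exact hgc.tendsto_c hpos hsum (mem_ball_zero_iff.1 hz)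
        ((hU {z} isCompact_singleton (Set.singleton_subset_iff.2 (hsub hz))).tendsto_at rfl)
  · have hU := hgc.tendstoUniformlyOn_closedBall hpos le_rfl (by simpa using hsum)
    exact ⟨_, hU, hU.continuousOn (Frequently.of_forall fun n => (hcont n).continuousOn)⟩
  · have hU : ∀ K : Set ℂ, IsCompact K → K ⊆ ball (0 : ℂ) R →
        TendstoUniformlyOn g (fun z => limUnder atTop fun n => g n z) atTop K := by
      intro K hK hKR
      obtain ⟨r, hrR, hKr⟩ := exists_lt_subset_ball hK.isClosed hKR
      have h1 : 1 ≤ max 1 r := le_max_left _ _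
      refine (hgc.tendstoUniformlyOn_closedBall hpos h1 ?_).mono
        (hKr.trans (ball_subset_closedBall.trans (closedBall_subset_closedBall (le_max_right _ _))))
      exact summable_weight_of_le_zpow (fun n => by positivity) (by linarith) (max_lt hR hrR) hle
    exact ⟨_, hU, differentiableOn_of_tendstoUniformlyOn_isCompact isOpen_ball
      (fun n => (hgc.differentiable hpos n).2) hU⟩
end

section
/- Let (a_n, b_n) be Jacobi parameters with Σ_{n≥1} (|b_n| + |a_n^2 − 1|) < ∞, with Jacobi operator J. Then for every z in the open unit disc with z ≠ 0 such that z + z^{-1} lies in the resolvent set of J, one has u(z) ≠ 0 and ⟨δ_1, (z + z^{-1} − J)^{-1} δ_1⟩ = z u^{(1)}(z) / (a_1 u(z)). -/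
open Complex Metric Filter Topology MeasureTheory

/-- `J` acts as the Jacobi matrix with parameters `a b` on `ℓ²(ℕ, ℂ)`; coordinate `n`
corresponds to the (1-indexed) site `n+1`. -/
def IsJacobiOpC (a b : ℕ → ℝ)
    (J : lp (fun _ : ℕ => ℂ) 2 →L[ℂ] lp (fun _ : ℕ => ℂ) 2) : Prop :=
  ∀ f : lp (fun _ : ℕ => ℂ) 2,
    ((J f : ∀ _ : ℕ, ℂ) 0 = (b 0 : ℂ) * (f : ∀ _ : ℕ, ℂ) 0 +
      (a 0 : ℂ) * (f : ∀ _ : ℕ, ℂ) 1) ∧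
    ∀ n : ℕ, (J f : ∀ _ : ℕ, ℂ) (n + 1) =
      (a n : ℂ) * (f : ∀ _ : ℕ, ℂ) n + (b (n + 1) : ℂ) * (f : ∀ _ : ℕ, ℂ) (n + 1) +
        (a (n + 1) : ℂ) * (f : ∀ _ : ℕ, ℂ) (n + 2)

/-- If `C` is contracted up to an error `G`, and the increments of `G` are controlled by `C` with
small summable weights, then the cone `θ ‖C‖ ≤ ‖G‖` is forward invariant, and `G` stays away from
zero along it. -/
theorem not_tendsto_zero_of_mem_cone {C G : ℕ → ℂ} {e : ℕ → ℝ} {ρ θ η : ℝ} (he : ∀ n, 0 ≤ e n)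
    (hes : ∀ n, ∑ i ∈ Finset.range n, e i ≤ η) (hθ : 0 < θ) (hρ : 0 ≤ ρ) (hη : 2 * η ≤ θ)
    (hcone : ρ * θ + θ ^ 2 + η ≤ θ)
    (hC : ∀ n, ‖C (n + 1)‖ ≤ ρ * ‖C n‖ + ‖G n‖)
    (hG : ∀ n, ‖G (n + 1) - G n‖ ≤ e n * ‖C n‖)
    (h0 : θ * ‖C 0‖ ≤ ‖G 0‖) (hG0 : G 0 ≠ 0) : ¬ Tendsto G atTop (𝓝 0) := by
  have key : ∀ n, θ * ‖C n‖ ≤ ‖G n‖ ∧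
      (θ - ∑ i ∈ Finset.range n, e i) * ‖G 0‖ ≤ θ * ‖G n‖ := by
    intro n
    induction n with
    | zero => exact ⟨h0, by simp⟩
    | succ n ih =>
      obtain ⟨ih1, ih2⟩ := ih
      have hs := hes (n + 1)
      have hs0 : 0 ≤ ∑ i ∈ Finset.range n, e i := Finset.sum_nonneg fun i _ => he i
      rw [Finset.sum_range_succ] at hs ⊢
      have hen := he n
      have h1 : θ * ‖G n‖ - e n * ‖G n‖ ≤ θ * ‖G (n + 1)‖ := by
        have h2 : ‖G n‖ - ‖G (n + 1)‖ ≤ e n * ‖C n‖ := by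
          have := norm_sub_norm_le (G n) (G (n + 1))
          rw [norm_sub_rev] at this
          exact this.trans (hG n)
        have h3 := mul_le_mul_of_nonneg_left h2 hθ.le
        have h4 := mul_le_mul_of_nonneg_left ih1 hen
        linarith
      constructor
      · have h5 := mul_le_mul_of_nonneg_left (hC n) (sq_nonneg θ)
        have h6 := mul_le_mul_of_nonneg_left ih1 (mul_nonneg hρ hθ.le)
        have h7 : (ρ * θ + θ ^ 2 + e n) * ‖G n‖ ≤ θ * ‖G n‖ := by
          gcongr
          linarith
        have h8 : θ * (θ * ‖C (n + 1)‖) ≤ θ * ‖G (n + 1)‖ := by nlinarith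
        exact le_of_mul_le_mul_left h8 hθ
      · have h9 := mul_le_mul_of_nonneg_left ih2 (by linarith : 0 ≤ θ - e n)
        have h10 : 0 ≤ e n * (∑ i ∈ Finset.range n, e i) * ‖G 0‖ := by positivity
        have h11 : θ * ((θ - (∑ i ∈ Finset.range n, e i + e n)) * ‖G 0‖) ≤
            θ * (θ * ‖G (n + 1)‖) := by nlinarith
        exact le_of_mul_le_mul_left h11 hθ
  intro h
  have hlim : Tendsto (fun n => θ * ‖G n‖) atTop (𝓝 0) := by
    simpa using h.norm.const_mul θ
  have hle : θ / 2 * ‖G 0‖ ≤ 0 := by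
    refine ge_of_tendsto' hlim fun n => le_trans ?_ (key n).2
    gcongr
    linarith [hes n]
  have : 0 < θ / 2 * ‖G 0‖ := by positivity
  linarith

/-- A solution of an asymptotically diagonal system whose neutral component `G` tends to zero
eventually has its contracted component `C` decaying at a rate as close to `r` as desired. -/
theorem eventually_norm_succ_le {C G : ℕ → ℂ} {e : ℕ → ℝ} {r θ : ℝ} (he : ∀ n, 0 ≤ e n)
    (hes : Summable e) (hr : 0 ≤ r) (hθ : 0 < θ) (hrθ : r + θ < 1)
    (hC : ∀ n, ‖C (n + 1)‖ ≤ (r + e n) * ‖C n‖ + ‖G n‖)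
    (hG : ∀ n, ‖G (n + 1) - G n‖ ≤ e n * ‖C n‖)
    (hlim : Tendsto G atTop (𝓝 0)) :
    ∀ᶠ n in atTop, ‖C (n + 1)‖ ≤ (r + 2 * θ) * ‖C n‖ := by
  set η : ℝ := θ * (1 - r - θ) / 2 with hηdef
  have hη : 0 < η := by
    have : 0 < 1 - r - θ := by linarith
    positivity
  filter_upwards [(tendsto_sum_nat_add e).eventually (gt_mem_nhds hη)] with n hn
  have hes' : Summable fun k => e (k + n) := (summable_nat_add_iff n).2 hes
  have hsum : ∀ k, ∑ i ∈ Finset.range k, e (i + n) ≤ η := fun k =>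
    (hes'.sum_le_tsum _ fun i _ => he _).trans hn.le
  have hη' : 2 * η ≤ θ := by nlinarith
  have hle : ∀ k, e (k + n) ≤ η := fun k =>
    (hes'.le_tsum k fun i _ => he _).trans hn.le
  have hG' : ‖G n‖ ≤ θ * ‖C n‖ := by
    by_contra! hcon
    refine not_tendsto_zero_of_mem_cone (C := fun k => C (k + n)) (G := fun k => G (k + n))
      (e := fun k => e (k + n)) (ρ := r + η) (θ := θ) (η := η) (fun k => he _) hsum hθ
      (by positivity) hη' (by nlinarith) (fun k => ?_) (fun k => ?_) (by simpa using hcon.le) ?_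
      ((tendsto_add_atTop_iff_nat n).2 hlim)
    · have := hC (k + n)
      rw [show k + 1 + n = k + n + 1 by ring]
      refine this.trans ?_
      gcongr
      exact hle k
    · have := hG (k + n)
      rwa [show k + 1 + n = k + n + 1 by ring]
    · have : 0 < ‖G n‖ := lt_of_le_of_lt (by positivity) hcon
      simpa using this
  have h0 := hle 0
  rw [zero_add] at h0
  have : (r + e n) * ‖C n‖ ≤ (r + θ) * ‖C n‖ := by
    gcongr
    linarith
  linarith [hC n]

section JacobiParameters

variable {a b : ℕ → ℝ}

theorem le_one_add_abs_sq_sub_one {x : ℝ} (hx : 0 < x) : x ≤ 1 + |x ^ 2 - 1| := by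
  rcases le_or_gt x 1 with h | h
  · linarith [abs_nonneg (x ^ 2 - 1)]
  · have := le_abs_self (x ^ 2 - 1)
    nlinarith

theorem prod_le_exp_tsum (hpos : ∀ n, 0 < a n)
    (hsum : Summable fun n => |b n| + |a n ^ 2 - 1|) (n : ℕ) :
    ∏ i ∈ Finset.range n, a i ≤ Real.exp (∑' n, (|b n| + |a n ^ 2 - 1|)) := by
  calc ∏ i ∈ Finset.range n, a i
      ≤ ∏ i ∈ Finset.range n, Real.exp (|b i| + |a i ^ 2 - 1|) := by
        refine Finset.prod_le_prod (fun i _ => (hpos i).le) fun i _ => ?_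
        have h1 := le_one_add_abs_sq_sub_one (hpos i)
        have h2 := Real.add_one_le_exp (|b i| + |a i ^ 2 - 1|)
        linarith [abs_nonneg (b i)]
    _ = Real.exp (∑ i ∈ Finset.range n, (|b i| + |a i ^ 2 - 1|)) := (Real.exp_sum _ _).symm
    _ ≤ _ := Real.exp_le_exp.2 (hsum.sum_le_tsum _ fun i _ => by positivity)

theorem tendsto_one_of_summable (hpos : ∀ n, 0 < a n)
    (hsum : Summable fun n => |b n| + |a n ^ 2 - 1|) : Tendsto a atTop (𝓝 1) := by
  rw [tendsto_iff_dist_tendsto_zero]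
  refine squeeze_zero (fun _ => dist_nonneg) (fun n => ?_) hsum.tendsto_atTop_zero
  rw [Real.dist_eq]
  have h1 : |a n ^ 2 - 1| = |a n - 1| * (a n + 1) := by
    rw [show a n ^ 2 - 1 = (a n - 1) * (a n + 1) by ring, abs_mul,
      abs_of_pos (by linarith [hpos n] : 0 < a n + 1)]
  nlinarith [abs_nonneg (b n), mul_nonneg (abs_nonneg (a n - 1)) (hpos n).le]

variable {c g : ℕ → ℂ → ℂ} {z : ℂ}

theorem GCRec.sub_eq (h : GCRec a b c g) (hpos : ∀ n, 0 < a n) (n : ℕ) (z : ℂ) :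
    g (n + 1) z = c (n + 1) z - (a n : ℂ) * z ^ 2 * c n z := by
  obtain ⟨-, -, hc, hg⟩ := h
  have ha : (a n : ℂ) ≠ 0 := by exact_mod_cast (hpos n).ne'
  apply mul_left_cancel₀ ha
  linear_combination hg n z - hc n z

/-- If `g n z → 0`, the orthonormal polynomials `z⁻ⁿ c n z` are absolutely summable. -/
theorem GCRec.summable_of_tendsto_zero (h : GCRec a b c g) (hpos : ∀ n, 0 < a n)
    (hsum : Summable fun n => |b n| + |a n ^ 2 - 1|) (hz : ‖z‖ < 1) (hz0 : z ≠ 0)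
    (hlim : Tendsto (fun n => g n z) atTop (𝓝 0)) :
    Summable fun n => ‖c n z / z ^ n‖ := by
  obtain ⟨-, -, hc, hg⟩ := h
  set P : ℕ → ℂ := fun n => ∏ i ∈ Finset.range n, (a i : ℂ) with hP
  have hPs : ∀ n, P (n + 1) = P n * a n := fun n => Finset.prod_range_succ _ _
  have hPnorm : ∀ n, ‖P n‖ = ∏ i ∈ Finset.range n, a i := fun n => by
    simp only [hP, norm_prod, Complex.norm_real, Real.norm_eq_abs, abs_of_pos (hpos _)]
  have hPpos : ∀ n, 0 < ‖P n‖ := fun n => by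
    rw [hPnorm]; exact Finset.prod_pos fun i _ => hpos i
  have hs : 0 < ‖z‖ := norm_pos_iff.2 hz0
  set s := ‖z‖ with hsdef
  set θ : ℝ := s * (1 - s) / 4 with hθdef
  have hθ : 0 < θ := by
    have : 0 < 1 - s := by linarith
    positivity
  have hGlim : Tendsto (fun n => P n * g n z) atTop (𝓝 0) := by
    rw [tendsto_zero_iff_norm_tendsto_zero]
    have := hlim.norm.const_mul (Real.exp (∑' n, (|b n| + |a n ^ 2 - 1|)))
    rw [norm_zero, mul_zero] at this
    refine squeeze_zero (fun _ => norm_nonneg _) (fun n => ?_) this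
    rw [norm_mul, hPnorm]
    exact mul_le_mul_of_nonneg_right (prod_le_exp_tsum hpos hsum n) (norm_nonneg _)
  have hbz : ∀ n, ‖(b n : ℂ) * z‖ ≤ |b n| := fun n => by
    rw [norm_mul, Complex.norm_real, Real.norm_eq_abs]
    exact mul_le_of_le_one_right (abs_nonneg _) hz.le
  have haz : ∀ n, ‖(1 - (a n : ℂ) ^ 2) * z ^ 2‖ ≤ |a n ^ 2 - 1| := fun n => by
    rw [norm_mul, norm_pow, show (1 - (a n : ℂ) ^ 2) = ((1 - a n ^ 2 : ℝ) : ℂ) by push_cast; ring,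
      Complex.norm_real, Real.norm_eq_abs, abs_sub_comm]
    exact mul_le_of_le_one_right (abs_nonneg _) (pow_le_one₀ (norm_nonneg _) hz.le)
  have hdecay := eventually_norm_succ_le (C := fun n => P n * c n z) (G := fun n => P n * g n z)
    (e := fun n => |b n| + |a n ^ 2 - 1|) (r := s ^ 2) (θ := θ) (fun n => by positivity) hsum
    (by positivity) hθ (by nlinarith) (fun n => ?_) (fun n => ?_) hGlim
  rotate_left
  · have : P (n + 1) * c (n + 1) z = (z ^ 2 - b n * z) * (P n * c n z) + P n * g n z := by
      rw [hPs]; linear_combination P n * hc n z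
    rw [this]
    refine (norm_add_le _ _).trans ?_
    rw [norm_mul (z ^ 2 - b n * z)]
    gcongr
    refine (norm_sub_le _ _).trans ?_
    rw [norm_pow]
    linarith [hbz n, abs_nonneg (a n ^ 2 - 1)]
  · have : P (n + 1) * g (n + 1) z - P n * g n z =
        ((1 - (a n : ℂ) ^ 2) * z ^ 2 - b n * z) * (P n * c n z) := by
      rw [hPs]; linear_combination P n * hg n z
    rw [this, norm_mul]
    gcongr
    refine (norm_sub_le _ _).trans ?_
    linarith [hbz n, haz n]
  have halim := (tendsto_one_of_summable hpos hsum).eventually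
    (lt_mem_nhds (show (2 * (1 + s)) / (3 + s) < 1 by rw [div_lt_one (by linarith)]; linarith))
  refine summable_of_ratio_norm_eventually_le (r := (3 + s) / 4) (by linarith) ?_
  filter_upwards [hdecay, halim] with n hn ha
  rw [div_lt_iff₀ (by linarith)] at ha
  simp only [norm_norm, norm_div, norm_pow]
  rw [hPs, norm_mul, norm_mul, norm_mul, Complex.norm_real, Real.norm_eq_abs,
    abs_of_pos (hpos n)] at hn
  have h1 : a n * ‖c (n + 1) z‖ ≤ s * ((1 + s) / 2) * ‖c n z‖ := by
    refine le_of_mul_le_mul_left ?_ (hPpos n)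
    calc ‖P n‖ * (a n * ‖c (n + 1) z‖) ≤ (s ^ 2 + 2 * θ) * (‖P n‖ * ‖c n z‖) := by linarith
      _ = _ := by rw [hθdef]; ring
  have h2 : ‖c (n + 1) z‖ ≤ s * ((3 + s) / 4) * ‖c n z‖ := by
    refine le_of_mul_le_mul_left ?_ (hpos n)
    refine h1.trans ?_
    have : (1 + s) / 2 ≤ a n * ((3 + s) / 4) := by linarith
    calc s * ((1 + s) / 2) * ‖c n z‖ ≤ s * (a n * ((3 + s) / 4)) * ‖c n z‖ := by gcongr
      _ = _ := by ring
  rw [← hsdef, div_le_iff₀ (by positivity)]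
  refine h2.trans (le_of_eq ?_)
  field_simp
  ring

/-- The solution of `(z + z⁻¹ - J) f = δ` in terms of the Geronimo–Case polynomials of the original
and of the once stripped parameters. -/
theorem GCRec.solution_eq {c₁ g₁ : ℕ → ℂ → ℂ} (h : GCRec a b c g)
    (h₁ : GCRec (fun k => a (k + 1)) (fun k => b (k + 1)) c₁ g₁) (hpos : ∀ n, 0 < a n)
    (hz0 : z ≠ 0) {f : ℕ → ℂ}
    (hf0 : (z + z⁻¹) * f 0 - (b 0 * f 0 + a 0 * f 1) = 1)
    (hf : ∀ n, (z + z⁻¹) * f (n + 1) -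
      (a n * f n + b (n + 1) * f (n + 1) + a (n + 1) * f (n + 2)) = 0) (n : ℕ) :
    a 0 * (z ^ (n + 1) * f (n + 1)) = a 0 * f 0 * c (n + 1) z - z * c₁ n z ∧
    a 0 * (z ^ (n + 1) * (f (n + 1) - a n * z * f n)) = a 0 * f 0 * g (n + 1) z - z * g₁ n z := by
  have ha : ∀ n, (a n : ℂ) ≠ 0 := fun n => by exact_mod_cast (hpos n).ne'
  have hsub := h.sub_eq hpos
  have hsub₁ := h₁.sub_eq fun n => hpos (n + 1)
  obtain ⟨hc0, hg0, hc, hg⟩ := h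
  obtain ⟨hc0₁, hg0₁, hc₁, hg₁⟩ := h₁
  have hE : z * z⁻¹ = 1 := mul_inv_cancel₀ hz0
  induction n with
  | zero =>
    have h1 := hc 0 z
    rw [hc0, hg0] at h1
    have h2 : a 0 * (z * f 1) = a 0 * f 0 * c 1 z - z := by
      linear_combination -z * hf0 + f 0 * hE - f 0 * h1
    refine ⟨by simpa [hc0₁] using h2, ?_⟩
    rw [hsub 0 z, hc0, hg0₁]
    simp only [zero_add, pow_one]
    linear_combination h2
  | succ n ih =>
    obtain ⟨ih1, ih2⟩ := ih
    have h2 : a 0 * (z ^ (n + 2) * f (n + 2)) =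
        a 0 * f 0 * c (n + 2) z - z * c₁ (n + 1) z := by
      apply mul_left_cancel₀ (ha (n + 1))
      linear_combination (z ^ 2 - b (n + 1) * z) * ih1 + ih2 - a 0 * z ^ (n + 2) * hf n
        + a 0 * z ^ (n + 1) * f (n + 1) * hE - a 0 * f 0 * hc (n + 1) z + z * hc₁ n z
    refine ⟨h2, ?_⟩
    rw [hsub (n + 1) z, hsub₁ n z]
    linear_combination h2 - a (n + 1) * z ^ 2 * ih1

end JacobiParameters

theorem statement16 (a b : ℕ → ℝ) (hpos : ∀ n, 0 < a n)
    (hsum : Summable fun n => |b n| + |a n ^ 2 - 1|)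
    (u u1 : ℂ → ℂ) (hu : IsJost a b u)
    (hu1 : IsJost (fun k => a (k + 1)) (fun k => b (k + 1)) u1)
    (J : lp (fun _ : ℕ => ℂ) 2 →L[ℂ] lp (fun _ : ℕ => ℂ) 2)
    (hJ : IsJacobiOpC a b J)
    (z : ℂ) (hz : z ∈ Metric.ball (0 : ℂ) 1) (hz0 : z ≠ 0)
    (hres : z + z⁻¹ ∉ spectrum ℂ J) :
    u z ≠ 0 ∧
    ((Ring.inverse ((z + z⁻¹) • (1 : lp (fun _ : ℕ => ℂ) 2 →L[ℂ] lp (fun _ : ℕ => ℂ) 2)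
        - J)) (lp.single 2 0 1) : ∀ _ : ℕ, ℂ) 0 = z * u1 z / ((a 0 : ℂ) * u z) := by
  have hz1 : ‖z‖ < 1 := by simpa using hz
  have hmem : z ∈ Metric.closedBall (0 : ℂ) 1 \ ({1, -1} : Set ℂ) := by
    refine ⟨Metric.ball_subset_closedBall hz, ?_⟩
    rintro (rfl | rfl) <;> simp at hz1
  have ha : ∀ n, (a n : ℂ) ≠ 0 := fun n => by exact_mod_cast (hpos n).ne'
  obtain ⟨c, g, hcg, hlim⟩ := hu
  obtain ⟨c₁, g₁, hcg₁, hlim₁⟩ := hu1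
  replace hlim := hlim z hmem
  replace hlim₁ := hlim₁ z hmem
  set T := (z + z⁻¹) • (1 : lp (fun _ : ℕ => ℂ) 2 →L[ℂ] lp (fun _ : ℕ => ℂ) 2) - J with hT
  have hunit : IsUnit T := by
    rw [spectrum.notMem_iff, Algebra.algebraMap_eq_smul_one] at hres
    exact hres
  have hTapp : ∀ f n, (T f : ∀ _ : ℕ, ℂ) n =
      (z + z⁻¹) * (f : ∀ _ : ℕ, ℂ) n - (J f : ∀ _ : ℕ, ℂ) n := fun f n => rfl
  have hne : u z ≠ 0 := by
    intro hu0
    rw [hu0] at hlim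
    have hs := hcg.summable_of_tendsto_zero hpos hsum hz1 hz0 hlim
    have hmem2 : Memℓp (E := fun _ : ℕ => ℂ) (fun n => c n z / z ^ n) 2 := by
      refine Memℓp.of_exponent_ge (q := 1) (memℓp_gen ?_) (by norm_num)
      simpa using hs
    set f : lp (fun _ : ℕ => ℂ) 2 := ⟨fun n => c n z / z ^ n, hmem2⟩ with hf
    have hfn : ∀ n, (f : ∀ _ : ℕ, ℂ) n = c n z / z ^ n := fun n => rfl
    have hsub := hcg.sub_eq hpos
    obtain ⟨hc0, hg0, hc, hg⟩ := hcg
    have hTf : T f = 0 := by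
      ext n
      rw [hTapp]
      change _ = (0 : ℂ)
      cases n with
      | zero =>
        have h1 := hc 0 z
        rw [hg0, hc0] at h1
        rw [(hJ f).1, hfn, hfn, hc0]
        simp only [pow_zero, pow_one]
        field_simp
        linear_combination -h1
      | succ n =>
        have h1 := hc (n + 1) z
        rw [hsub n z] at h1
        rw [(hJ f).2 n, hfn, hfn, hfn]
        field_simp
        linear_combination -z ^ (2 * n + 2) * h1
    have hf0 : f = 0 := by
      obtain ⟨S, hS⟩ := hunit.exists_left_inv
      calc f = (S * T) f := by rw [hS]; rfl
        _ = S (T f) := rfl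
        _ = 0 := by rw [hTf, map_zero]
    have h0 : (f : ∀ _ : ℕ, ℂ) 0 = 0 := by rw [hf0]; rfl
    rw [hfn, hc0] at h0
    simp at h0
  refine ⟨hne, ?_⟩
  set f := Ring.inverse T (lp.single 2 0 1) with hf
  have hTf : T f = lp.single 2 0 1 := by
    calc T f = (T * Ring.inverse T) (lp.single 2 0 1) := rfl
      _ = _ := by rw [Ring.mul_inverse_cancel _ hunit]; rfl
  have hsol := hcg.solution_eq hcg₁ hpos hz0 (f := fun n => (f : ∀ _ : ℕ, ℂ) n)
    (by
      have := hTapp f 0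
      rw [hTf, (hJ f).1] at this
      rw [← this]
      simp)
    (fun n => by
      have := hTapp f (n + 1)
      rw [hTf, (hJ f).2 n] at this
      rw [← this]
      simp)
  have hleft : Tendsto (fun n => (a 0 : ℂ) * (z ^ (n + 1) *
      ((f : ∀ _ : ℕ, ℂ) (n + 1) - a n * z * (f : ∀ _ : ℕ, ℂ) n))) atTop (𝓝 0) := by
    have hfb : ∀ n, ‖(f : ∀ _ : ℕ, ℂ) n‖ ≤ ‖f‖ := lp.norm_apply_le_norm (by norm_num) f
    obtain ⟨A, hA⟩ := (tendsto_one_of_summable hpos hsum).bddAbove_range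
    have hA' : ∀ n, a n ≤ A := fun n => hA ⟨n, rfl⟩
    have hA0 : 0 ≤ A := (hpos 0).le.trans (hA' 0)
    have hpow : Tendsto (fun n => z ^ (n + 1)) atTop (𝓝 0) :=
      (tendsto_add_atTop_iff_nat 1).2 (tendsto_pow_atTop_nhds_zero_of_norm_lt_one hz1)
    have hprod := hpow.zero_mul_isBoundedUnder_le
      (g := fun n => (f : ∀ _ : ℕ, ℂ) (n + 1) - a n * z * (f : ∀ _ : ℕ, ℂ) n)
      (isBoundedUnder_of ⟨‖f‖ + A * 1 * ‖f‖, fun n => by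
        refine (norm_sub_le _ _).trans ?_
        rw [norm_mul, norm_mul, Complex.norm_real, Real.norm_eq_abs, abs_of_pos (hpos n)]
        gcongr
        exacts [hfb _, hA' n, hfb n]⟩)
    simpa using hprod.const_mul (a 0 : ℂ)
  have hright := (((tendsto_add_atTop_iff_nat 1).2 hlim).const_mul
    ((a 0 : ℂ) * (f : ∀ _ : ℕ, ℂ) 0)).sub (hlim₁.const_mul z)
  have heq := tendsto_nhds_unique (hleft.congr fun n => (hsol n).2) hright
  rw [eq_div_iff (mul_ne_zero (ha 0) hne)]
  linear_combination -heq
end
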